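/- arXiv:1703.10761 — 11 statements merged into one kernel-verified Lean document; each statement's English description precedes it below -/
import Mathlib

section
/- (Variational characterization of gamblets, Theorem 6.4 of the paper.) For every c ∈ ℝ^m, the element Σ_{i=1}^m c_i ψ_i is the unique minimizer of ‖v‖ over v ∈ H subject to the constraints φ_j(v) = c_j for j = 1,…,m; in particular ψ_i is the unique minimizer of ‖v‖ subject to φ_j(v) = δ_{ij} for all j. Moreover ⟨ψ_i, ψ_j⟩ = (Θ⁻¹)_{ij} for all i, j, and for every u ∈ H the element Σ_{i=1}^m φ_i(u) ψ_i is the unique minimizer of ‖u − v‖ over v ∈ span{ψ_1,…,ψ_m}. -/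
open scoped RealInnerProductSpace BigOperators

theorem pyth_aux {H : Type*} [NormedAddCommGroup H] [InnerProductSpace ℝ H] (a b : H)
    (hab : ⟪a, b - a⟫ = 0) : ‖a‖ ≤ ‖b‖ ∧ (‖b‖ = ‖a‖ → b = a) := by
  have e : ‖b‖ * ‖b‖ = ‖a‖ * ‖a‖ + ‖b - a‖ * ‖b - a‖ := by
    have := norm_add_sq_eq_norm_sq_add_norm_sq_of_inner_eq_zero a (b - a) hab
    rwa [add_sub_cancel] at this
  constructor
  · nlinarith [norm_nonneg a, norm_nonneg b, mul_self_nonneg ‖b - a‖]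
  · intro hn
    rw [hn] at e
    have h0 : ‖b - a‖ = 0 := mul_self_eq_zero.mp (by linarith)
    exact sub_eq_zero.mp (norm_eq_zero.mp h0)

theorem stmt1 {H : Type*} [NormedAddCommGroup H] [InnerProductSpace ℝ H] [CompleteSpace H]
    {m : ℕ} (φ : Fin m → H →L[ℝ] ℝ) (hφ : LinearIndependent ℝ φ)
    (h : Fin m → H) (hRiesz : ∀ i u, φ i u = ⟪h i, u⟫)
    (Θ : Matrix (Fin m) (Fin m) ℝ) (hΘ : ∀ i j, Θ i j = ⟪h i, h j⟫)
    (hΘdet : IsUnit Θ.det)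
    (ψ : Fin m → H) (hψ : ∀ i, ψ i = ∑ j, Θ⁻¹ i j • h j) :
    (∀ c : Fin m → ℝ,
      (∀ j, φ j (∑ i, c i • ψ i) = c j) ∧
      (∀ v : H, (∀ j, φ j v = c j) → ‖∑ i, c i • ψ i‖ ≤ ‖v‖) ∧
      (∀ v : H, (∀ j, φ j v = c j) → ‖v‖ = ‖∑ i, c i • ψ i‖ → v = ∑ i, c i • ψ i)) ∧
    (∀ i j, ⟪ψ i, ψ j⟫ = Θ⁻¹ i j) ∧
    (∀ u : H,
      (∑ i, φ i u • ψ i) ∈ Submodule.span ℝ (Set.range ψ) ∧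
      (∀ v ∈ Submodule.span ℝ (Set.range ψ), ‖u - ∑ i, φ i u • ψ i‖ ≤ ‖u - v‖) ∧
      (∀ v ∈ Submodule.span ℝ (Set.range ψ),
        ‖u - v‖ = ‖u - ∑ i, φ i u • ψ i‖ → v = ∑ i, φ i u • ψ i)) := by
  have hδ : ∀ j i, ⟪h j, ψ i⟫ = if i = j then (1 : ℝ) else 0 := by
    intro j i
    have e : (Θ⁻¹ * Θ) i j = (1 : Matrix (Fin m) (Fin m) ℝ) i j := by
      rw [Matrix.nonsing_inv_mul Θ hΘdet]
    rw [Matrix.mul_apply, Matrix.one_apply] at e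
    rw [← e, hψ, inner_sum]
    refine Finset.sum_congr rfl fun k _ => ?_
    rw [inner_smul_right, hΘ, real_inner_comm]
  have hc : ∀ (c : Fin m → ℝ) j, φ j (∑ i, c i • ψ i) = c j := by
    intro c j
    rw [hRiesz, inner_sum]
    simp [inner_smul_right, hδ]
  have horth : ∀ w, (∀ j, φ j w = 0) → ∀ s ∈ Submodule.span ℝ (Set.range ψ), ⟪s, w⟫ = 0 := by
    intro w hw s hs
    induction hs using Submodule.span_induction with
    | mem x hx =>
      obtain ⟨i, rfl⟩ := hx
      rw [hψ, sum_inner]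
      refine Finset.sum_eq_zero fun k _ => ?_
      rw [real_inner_smul_left, ← hRiesz, hw, mul_zero]
    | zero => exact inner_zero_left _
    | add x y _ _ hx hy => rw [inner_add_left, hx, hy, add_zero]
    | smul a x _ hx => rw [real_inner_smul_left, hx, mul_zero]
  have hmem : ∀ c : Fin m → ℝ, (∑ i, c i • ψ i) ∈ Submodule.span ℝ (Set.range ψ) := fun c =>
    Submodule.sum_mem _ fun i _ => Submodule.smul_mem _ _ (Submodule.subset_span ⟨i, rfl⟩)
  have h1 : ∀ (c : Fin m → ℝ) (v : H), (∀ j, φ j v = c j) →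
      ⟪∑ i, c i • ψ i, v - ∑ i, c i • ψ i⟫ = 0 := by
    intro c v hv
    refine horth _ (fun j => ?_) _ (hmem c)
    rw [map_sub, hv, hc, sub_self]
  have h2 : ∀ u : H, ∀ v ∈ Submodule.span ℝ (Set.range ψ),
      ⟪u - ∑ i, φ i u • ψ i, (u - v) - (u - ∑ i, φ i u • ψ i)⟫ = 0 := by
    intro u v hv
    rw [real_inner_comm, sub_sub_sub_cancel_left]
    refine horth _ (fun j => ?_) _ (Submodule.sub_mem _ (hmem _) hv)
    rw [map_sub, hc (fun i => φ i u), sub_self]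
  refine ⟨fun c => ⟨hc c, fun v hv => (pyth_aux _ _ (h1 c v hv)).1,
    fun v hv => (pyth_aux _ _ (h1 c v hv)).2⟩, fun i j => ?_, fun u => ⟨hmem _,
    fun v hv => (pyth_aux _ _ (h2 u v hv)).1,
    fun v hv hn => sub_right_injective ((pyth_aux _ _ (h2 u v hv)).2 hn)⟩⟩
  rw [hψ i, sum_inner]
  simp [real_inner_smul_left, hδ]
end

section
/- (Micchelli's optimal recovery theorem, Theorem 5.1/Corollary 5.2 of the paper.) Let Φ : H → ℝ^m be the information map Φ(u) := (φ_1(u),…,φ_m(u)), and assume there exists u* ≠ 0 in H with Φ(u*) = 0. Then: (i) for every function Ψ : ℝ^m → H, sup_{u ∈ H, u ≠ 0} ‖u − Ψ(Φ(u))‖/‖u‖ ≥ 1; (ii) for the map Ψ*(x) := Σ_{i=1}^m x_i ψ_i, one has sup_{u ∈ H, u ≠ 0} ‖u − Ψ*(Φ(u))‖/‖u‖ ≤ 1. Consequently, the minimax value inf_{Ψ : ℝ^m → H} sup_{u ≠ 0} ‖u − Ψ(Φ(u))‖/‖u‖ equals 1 and is attained by Ψ*, i.e. by the orthogonal projection u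 ↦ Σ_{i=1}^m φ_i(u) ψ_i of H onto span{h_1,…,h_m}. -/
open scoped RealInnerProductSpace BigOperators

/-- Part (i) with the supremum taken over nonzero `u` only, as in the informal statement. -/
theorem lower_bound_nonzero {H : Type*} [NormedAddCommGroup H] [InnerProductSpace ℝ H]
    {m : ℕ} (φ : Fin m → H →L[ℝ] ℝ) (hex : ∃ u : H, u ≠ 0 ∧ ∀ i, φ i u = 0)
    (Ψ : (Fin m → ℝ) → H) (C : ℝ)
    (hC : ∀ u : H, u ≠ 0 → ‖u - Ψ (fun i => φ i u)‖ ≤ C * ‖u‖) : 1 ≤ C := by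
  obtain ⟨u, hu, h0⟩ := hex
  have h1 := hC u hu
  have h2 := hC (-u) (neg_ne_zero.mpr hu)
  simp only [map_neg, h0, neg_zero, norm_neg] at h1 h2
  have h3 := norm_sub_le (u - Ψ fun _ => 0) (-u - Ψ fun _ => 0)
  have h4 : (u - Ψ fun _ => 0) - (-u - Ψ fun _ => 0) = (2 : ℝ) • u := by
    rw [two_smul]; abel
  rw [h4, norm_smul] at h3
  norm_num at h3
  have hp : 0 < ‖u‖ := norm_pos_iff.mpr hu
  by_contra hlt
  push Not at hlt
  nlinarith

theorem stmt2 {H : Type*} [NormedAddCommGroup H] [InnerProductSpace ℝ H] [CompleteSpace H]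
    {m : ℕ} (φ : Fin m → H →L[ℝ] ℝ) (hφ : LinearIndependent ℝ φ)
    (h : Fin m → H) (hRiesz : ∀ i u, φ i u = ⟪h i, u⟫)
    (Θ : Matrix (Fin m) (Fin m) ℝ) (hΘ : ∀ i j, Θ i j = ⟪h i, h j⟫)
    (hΘdet : IsUnit Θ.det)
    (ψ : Fin m → H) (hψ : ∀ i, ψ i = ∑ j, Θ⁻¹ i j • h j)
    (hex : ∃ u : H, u ≠ 0 ∧ ∀ i, φ i u = 0) :
    (∀ Ψ : (Fin m → ℝ) → H, ∀ C : ℝ,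
      (∀ u : H, ‖u - Ψ (fun i => φ i u)‖ ≤ C * ‖u‖) → 1 ≤ C) ∧
    (∀ u : H, ‖u - (fun x : Fin m → ℝ => ∑ i, x i • ψ i) (fun i => φ i u)‖ ≤ ‖u‖) := by
  refine ⟨fun Ψ C hC => lower_bound_nonzero φ hex Ψ C fun u _ => hC u, fun u => ?_⟩
  have hdual : ∀ k i, φ k (ψ i) = if i = k then 1 else 0 := by
    intro k i
    have e : (Θ⁻¹ * Θ) i k = (1 : Matrix (Fin m) (Fin m) ℝ) i k := by
      rw [Matrix.nonsing_inv_mul _ hΘdet]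
    rw [Matrix.mul_apply, Matrix.one_apply] at e
    rw [← e, hψ, map_sum]
    refine Finset.sum_congr rfl fun j _ => ?_
    rw [map_smul, hRiesz, hΘ, real_inner_comm, smul_eq_mul]
  show ‖u - ∑ i, φ i u • ψ i‖ ≤ ‖u‖
  set p : H := ∑ i, φ i u • ψ i with hp
  have hk : ∀ k, ⟪h k, u - p⟫ = 0 := by
    intro k
    rw [← hRiesz, map_sub, hp, map_sum]
    simp [hdual]
  have horth : ⟪p, u - p⟫ = 0 := by
    have : ∀ i, ⟪ψ i, u - p⟫ = 0 := by
      intro i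
      rw [hψ, sum_inner]
      simp [real_inner_smul_left, hk]
    conv_lhs => rw [hp, sum_inner]
    refine Finset.sum_eq_zero fun i _ => ?_
    rw [real_inner_smul_left, ← hp, this, mul_zero]
  have hpy := norm_add_sq_eq_norm_sq_add_norm_sq_of_inner_eq_zero p (u - p) horth
  rw [add_sub_cancel] at hpy
  nlinarith [norm_nonneg u, norm_nonneg (u - p), norm_nonneg p]
end

section
/- (Multiresolution orthogonal decomposition, Theorem 3.8 of the paper.) For every 2 ≤ k ≤ q one has V^(k−1) ⊆ V^(k), and 𝔚^(k) is the orthogonal complement of V^(k−1) in V^(k), i.e. V^(k) = V^(k−1) ⊕ 𝔚^(k) with ⟨v,w⟩ = 0 for v ∈ V^(k−1), w ∈ 𝔚^(k). Consequently, writing 𝔚^(q+1) for the orthogonal complement of V^(q) in H, one has the orthogonal direct sum decomposition H = V^(1) ⊕ 𝔚^(2) ⊕ ⋯ ⊕ 𝔚^(q) ⊕ 𝔚^(q+1); moreover, for every u ∈ H, setting u^(k) := Σ_{i∈I^(k)} φ_i^(k)(u) ψ_i^(k), the decomposition u = u^(1) + (u^(2) − u^(1)) + ⋯ + (u^(q)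 − u^(q−1)) + (u − u^(q)) is the orthogonal decomposition of u corresponding to this direct sum (in particular each summand lies in the corresponding subspace and distinct summands are orthogonal). -/
open scoped RealInnerProductSpace Matrix BigOperators

theorem stmt3 {H : Type*} [NormedAddCommGroup H] [InnerProductSpace ℝ H] [CompleteSpace H]
    (q : ℕ) (hq : 2 ≤ q)
    (I : ℕ → Type) [∀ k, Fintype (I k)] [∀ k, DecidableEq (I k)] [∀ k, Nonempty (I k)]
    (J : ℕ → Type) [∀ k, Fintype (J k)] [∀ k, DecidableEq (J k)]
    (φ : ∀ k, I k → (H →L[ℝ] ℝ))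
    (hφq : LinearIndependent ℝ (φ q))
    (pim : ∀ k, Matrix (I k) (I (k + 1)) ℝ)
    (hrank : ∀ k, 1 ≤ k → k < q → (pim k).rank = Fintype.card (I k))
    (hnest : ∀ k, 1 ≤ k → k < q → ∀ i, φ k i = ∑ j, pim k i j • φ (k + 1) j)
    (h : ∀ k, I k → H)
    (hR : ∀ k i u, φ k i u = ⟪h k i, u⟫)
    (Θ : ∀ k, Matrix (I k) (I k) ℝ)
    (hΘ : ∀ k i j, Θ k i j = φ k i (h k j))
    (hΘdet : ∀ k, 1 ≤ k → k ≤ q → IsUnit (Θ k).det)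
    (ψ : ∀ k, I k → H)
    (hψ : ∀ k, 1 ≤ k → k ≤ q → ∀ i, ψ k i = ∑ j, (Θ k)⁻¹ i j • h k j)
    (hJcard : ∀ k, 1 ≤ k → k < q →
      Fintype.card (J (k + 1)) = Fintype.card (I (k + 1)) - Fintype.card (I k))
    (W : ∀ k, Matrix (J k) (I k) ℝ)
    (hW : ∀ k, 1 ≤ k → k < q →
      LinearMap.range (Matrix.mulVecLin ((W (k + 1))ᵀ)) =
        LinearMap.ker (Matrix.mulVecLin (pim k)))
    (χ : ∀ k, J k → H)
    (hχ : ∀ k, 1 ≤ k → k < q → ∀ i, χ (k + 1) i = ∑ j, W (k + 1) i j • ψ (k + 1) j) :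
    (∀ k, 1 ≤ k → k < q →
      Submodule.span ℝ (Set.range (ψ k)) ≤ Submodule.span ℝ (Set.range (ψ (k + 1)))) ∧
    (∀ k, 1 ≤ k → k < q →
      (∀ v ∈ Submodule.span ℝ (Set.range (ψ k)),
        ∀ w ∈ Submodule.span ℝ (Set.range (χ (k + 1))), ⟪v, w⟫ = 0) ∧
      Submodule.span ℝ (Set.range (ψ (k + 1))) =
        Submodule.span ℝ (Set.range (ψ k)) ⊔ Submodule.span ℝ (Set.range (χ (k + 1)))) ∧
    ((⊤ : Submodule ℝ H) =
      Submodule.span ℝ (Set.range (ψ 1)) ⊔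
        (⨆ k ∈ Finset.Ico 1 q, Submodule.span ℝ (Set.range (χ (k + 1)))) ⊔
        (Submodule.span ℝ (Set.range (ψ q)))ᗮ) ∧
    (∀ k l, 1 ≤ k → k < l → l < q →
      ∀ w ∈ Submodule.span ℝ (Set.range (χ (k + 1))),
      ∀ w' ∈ Submodule.span ℝ (Set.range (χ (l + 1))), ⟪w, w'⟫ = 0) ∧
    (∀ k, 1 ≤ k → k < q →
      ∀ v ∈ Submodule.span ℝ (Set.range (ψ 1)),
      ∀ w ∈ Submodule.span ℝ (Set.range (χ (k + 1))), ⟪v, w⟫ = 0) ∧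
    (∀ k, 1 ≤ k → k < q →
      ∀ w ∈ Submodule.span ℝ (Set.range (χ (k + 1))),
      ∀ z ∈ (Submodule.span ℝ (Set.range (ψ q)))ᗮ, ⟪w, z⟫ = 0) ∧
    (∀ v ∈ Submodule.span ℝ (Set.range (ψ 1)),
      ∀ z ∈ (Submodule.span ℝ (Set.range (ψ q)))ᗮ, ⟪v, z⟫ = 0) ∧
    (∀ u : H,
      (∑ i, φ 1 i u • ψ 1 i) ∈ Submodule.span ℝ (Set.range (ψ 1)) ∧
      (∀ k, 1 ≤ k → k < q →
        ((∑ i, φ (k + 1) i u • ψ (k + 1) i) - ∑ i, φ k i u • ψ k i) ∈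
          Submodule.span ℝ (Set.range (χ (k + 1)))) ∧
      (u - ∑ i, φ q i u • ψ q i) ∈ (Submodule.span ℝ (Set.range (ψ q)))ᗮ ∧
      u = (∑ i, φ 1 i u • ψ 1 i) +
          (∑ k ∈ Finset.Ico 1 q,
            ((∑ i, φ (k + 1) i u • ψ (k + 1) i) - ∑ i, φ k i u • ψ k i)) +
          (u - ∑ i, φ q i u • ψ q i)) := by
  classical
  have hreal : ∀ (k : ℕ) (i : I k) (u : H), ⟪h k i, u⟫ = φ k i u := fun k i u => (hR k i u).symm
  have hsymm : ∀ k i j, Θ k i j = Θ k j i := by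
    intro k i j
    rw [hΘ, hΘ, hR, hR, real_inner_comm]
  -- gamblets lie in the span of the Riesz representatives
  have hψh : ∀ k, 1 ≤ k → k ≤ q →
      Submodule.span ℝ (Set.range (ψ k)) ≤ Submodule.span ℝ (Set.range (h k)) := by
    intro k h1 h2
    rw [Submodule.span_le]
    rintro _ ⟨i, rfl⟩
    rw [hψ k h1 h2 i]
    exact Submodule.sum_mem _ fun j _ =>
      Submodule.smul_mem _ _ (Submodule.subset_span ⟨j, rfl⟩)
  have hhψ' : ∀ k, 1 ≤ k → k ≤ q → ∀ i, h k i = ∑ j, Θ k i j • ψ k j := by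
    intro k h1 h2 i
    have e : ∀ l, ∑ j, Θ k i j * (Θ k)⁻¹ j l = if i = l then 1 else 0 := by
      intro l
      have := congrFun (congrFun (Matrix.mul_nonsing_inv (Θ k) (hΘdet k h1 h2)) i) l
      rwa [Matrix.mul_apply, Matrix.one_apply] at this
    calc h k i = ∑ l, (if i = l then (1:ℝ) else 0) • h k l := by simp
      _ = ∑ l, (∑ j, Θ k i j * (Θ k)⁻¹ j l) • h k l := by simp only [e]
      _ = ∑ l, ∑ j, Θ k i j • (Θ k)⁻¹ j l • h k l := by
          simp only [Finset.sum_smul, mul_smul]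
      _ = ∑ j, Θ k i j • ψ k j := by
          rw [Finset.sum_comm]
          refine Finset.sum_congr rfl fun j _ => ?_
          rw [hψ k h1 h2 j, Finset.smul_sum]
  have hhψ : ∀ k, 1 ≤ k → k ≤ q →
      Submodule.span ℝ (Set.range (h k)) ≤ Submodule.span ℝ (Set.range (ψ k)) := by
    intro k h1 h2
    rw [Submodule.span_le]
    rintro _ ⟨i, rfl⟩
    rw [hhψ' k h1 h2 i]
    exact Submodule.sum_mem _ fun j _ =>
      Submodule.smul_mem _ _ (Submodule.subset_span ⟨j, rfl⟩)
  have hdual : ∀ k, 1 ≤ k → k ≤ q → ∀ i j, φ k i (ψ k j) = if j = i then 1 else 0 := by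
    intro k h1 h2 i j
    have := congrFun (congrFun (Matrix.nonsing_inv_mul (Θ k) (hΘdet k h1 h2)) j) i
    rw [Matrix.mul_apply, Matrix.one_apply] at this
    rw [hψ k h1 h2 j, map_sum, ← this]
    refine Finset.sum_congr rfl fun l _ => ?_
    rw [map_smul, smul_eq_mul, ← hΘ, hsymm]
  have hcoef : ∀ k, 1 ≤ k → k ≤ q → ∀ (c : I k → ℝ) i, φ k i (∑ j, c j • ψ k j) = c i := by
    intro k h1 h2 c i
    simp [map_sum, hdual k h1 h2]
  -- orthogonality to V^(k) from vanishing of the functionals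
  have hperp : ∀ k, 1 ≤ k → k ≤ q → ∀ z : H, (∀ i, φ k i z = 0) →
      ∀ v ∈ Submodule.span ℝ (Set.range (ψ k)), ⟪v, z⟫ = 0 := by
    intro k h1 h2 z hz v hv
    obtain ⟨c, rfl⟩ := (Submodule.mem_span_range_iff_exists_fun ℝ).1 (hψh k h1 h2 hv)
    simp [sum_inner, real_inner_smul_left, hreal, hz]
  have hPmem : ∀ k (c : I k → ℝ), (∑ i, c i • ψ k i) ∈ Submodule.span ℝ (Set.range (ψ k)) :=
    fun k c => Submodule.sum_mem _ fun j _ =>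
      Submodule.smul_mem _ _ (Submodule.subset_span ⟨j, rfl⟩)
  have hPid : ∀ k, 1 ≤ k → k ≤ q → ∀ v ∈ Submodule.span ℝ (Set.range (ψ k)),
      (∑ i, φ k i v • ψ k i) = v := by
    intro k h1 h2 v hv
    obtain ⟨c, rfl⟩ := (Submodule.mem_span_range_iff_exists_fun ℝ).1 hv
    simp only [hcoef k h1 h2]
  have hnest' : ∀ k, 1 ≤ k → k < q → ∀ i u, φ k i u = ∑ j, pim k i j * φ (k + 1) j u := by
    intro k h1 h2 i u
    rw [hnest k h1 h2 i]
    simp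
  have hmono : ∀ k, 1 ≤ k → k < q →
      Submodule.span ℝ (Set.range (ψ k)) ≤ Submodule.span ℝ (Set.range (ψ (k + 1))) := by
    intro k h1 h2
    refine (hψh k h1 h2.le).trans (le_trans ?_ (hhψ (k + 1) (by omega) h2))
    rw [Submodule.span_le]
    rintro _ ⟨i, rfl⟩
    have : h k i = ∑ j, pim k i j • h (k + 1) j := by
      refine ext_inner_right ℝ fun u => ?_
      rw [hreal, hnest' k h1 h2, sum_inner]
      refine Finset.sum_congr rfl fun j _ => ?_
      rw [real_inner_smul_left, hreal]
    rw [this]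
    exact Submodule.sum_mem _ fun j _ =>
      Submodule.smul_mem _ _ (Submodule.subset_span ⟨j, rfl⟩)
  have hmono' : ∀ k l, 1 ≤ k → k ≤ l → l ≤ q →
      Submodule.span ℝ (Set.range (ψ k)) ≤ Submodule.span ℝ (Set.range (ψ l)) := by
    intro k l h1 hkl
    induction l, hkl using Nat.le_induction with
    | base => intro _; exact le_rfl
    | succ n hn ih =>
      intro h2
      exact (ih (by omega)).trans (hmono n (by omega) (by omega))
  have hχV : ∀ k, 1 ≤ k → k < q →
      Submodule.span ℝ (Set.range (χ (k + 1))) ≤ Submodule.span ℝ (Set.range (ψ (k + 1))) := by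
    intro k h1 h2
    rw [Submodule.span_le]
    rintro _ ⟨i, rfl⟩
    rw [hχ k h1 h2]
    exact hPmem _ _
  have hχ0 : ∀ k, 1 ≤ k → k < q → ∀ i a, φ k i (χ (k + 1) a) = 0 := by
    intro k h1 h2 i a
    rw [hnest' k h1 h2, hχ k h1 h2]
    simp only [hcoef (k + 1) (by omega) h2]
    have hm : (W (k + 1))ᵀ.mulVecLin (Pi.single a 1) ∈ LinearMap.ker (pim k).mulVecLin := by
      rw [← hW k h1 h2]; exact ⟨_, rfl⟩
    rw [LinearMap.mem_ker] at hm
    have := congrFun hm i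
    simpa [Matrix.mulVec, dotProduct, Matrix.col] using this
  have hχ0' : ∀ k, 1 ≤ k → k < q → ∀ w ∈ Submodule.span ℝ (Set.range (χ (k + 1))),
      ∀ i, φ k i w = 0 := by
    intro k h1 h2 w hw i
    obtain ⟨c, rfl⟩ := (Submodule.mem_span_range_iff_exists_fun ℝ).1 hw
    simp [map_sum, hχ0 k h1 h2]
  have horth : ∀ k, 1 ≤ k → k < q → ∀ v ∈ Submodule.span ℝ (Set.range (ψ k)),
        ∀ w ∈ Submodule.span ℝ (Set.range (χ (k + 1))), ⟪v, w⟫ = 0 :=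
    fun k h1 h2 v hv w hw => hperp k h1 h2.le w (hχ0' k h1 h2 w hw) v hv
  have hF : ∀ k, 1 ≤ k → k < q → ∀ w ∈ Submodule.span ℝ (Set.range (ψ (k + 1))),
      (∀ i, φ k i w = 0) → w ∈ Submodule.span ℝ (Set.range (χ (k + 1))) := by
    intro k h1 h2 w hw h0
    obtain ⟨c, rfl⟩ := (Submodule.mem_span_range_iff_exists_fun ℝ).1 hw
    have hc : c ∈ LinearMap.ker (pim k).mulVecLin := by
      rw [LinearMap.mem_ker]
      ext i
      have := h0 i
      rw [hnest' k h1 h2] at this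
      simp only [hcoef (k + 1) (by omega) h2] at this
      exact this
    rw [← hW k h1 h2] at hc
    obtain ⟨d, rfl⟩ := hc
    refine (Submodule.mem_span_range_iff_exists_fun ℝ).2 ⟨d, ?_⟩
    simp only [hχ k h1 h2, Finset.smul_sum, Matrix.mulVecLin_apply, Matrix.mulVec, dotProduct,
      Finset.sum_smul, Matrix.transpose_apply, smul_smul]
    rw [Finset.sum_comm]
    simp only [mul_comm]
  have hG : ∀ u k, 1 ≤ k → k < q →
        ((∑ i, φ (k + 1) i u • ψ (k + 1) i) - ∑ i, φ k i u • ψ k i) ∈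
          Submodule.span ℝ (Set.range (χ (k + 1))) := by
    intro u k h1 h2
    refine hF k h1 h2 _ (Submodule.sub_mem _ (hPmem _ _) (hmono k h1 h2 (hPmem _ _))) ?_
    intro i
    rw [map_sub, hcoef k h1 h2.le, hnest' k h1 h2, hnest' k h1 h2]
    simp only [hcoef (k + 1) (by omega) h2, sub_self]
  have hlast : ∀ u, (u - ∑ i, φ q i u • ψ q i) ∈ (Submodule.span ℝ (Set.range (ψ q)))ᗮ := by
    intro u
    rw [Submodule.mem_orthogonal]
    refine hperp q (by omega) le_rfl _ ?_
    intro i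
    rw [map_sub, hcoef q (by omega) le_rfl, sub_self]
  have hdec : ∀ u, u = (∑ i, φ 1 i u • ψ 1 i) +
          (∑ k ∈ Finset.Ico 1 q,
            ((∑ i, φ (k + 1) i u • ψ (k + 1) i) - ∑ i, φ k i u • ψ k i)) +
          (u - ∑ i, φ q i u • ψ q i) := by
    intro u
    rw [Finset.sum_Ico_sub (fun k => ∑ i, φ k i u • ψ k i) (by omega : 1 ≤ q)]
    abel
  refine ⟨hmono, fun k h1 h2 => ⟨horth k h1 h2, ?_⟩, ?_, ?_, ?_, ?_, ?_, fun u =>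
    ⟨hPmem _ _, hG u, hlast u, hdec u⟩⟩
  · refine le_antisymm ?_ (sup_le (hmono k h1 h2) (hχV k h1 h2))
    intro v hv
    have e : v = (∑ i, φ k i v • ψ k i) +
        ((∑ i, φ (k + 1) i v • ψ (k + 1) i) - ∑ i, φ k i v • ψ k i) := by
      rw [hPid (k + 1) (by omega) h2 v hv]; abel
    rw [e]
    exact Submodule.add_mem_sup (hPmem _ _) (hG v k h1 h2)
  · refine (eq_top_iff.2 fun u _ => ?_).symm
    rw [hdec u]
    refine Submodule.add_mem_sup (Submodule.add_mem_sup (hPmem _ _) ?_) (hlast u)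
    refine Submodule.sum_mem _ fun k hk => ?_
    have hk' := Finset.mem_Ico.1 hk
    exact Submodule.mem_iSup_of_mem k (Submodule.mem_iSup_of_mem hk (hG u k hk'.1 hk'.2))
  · intro k l h1 hkl h2 w hw w' hw'
    exact horth l (by omega) h2 w
      (hmono' (k + 1) l (by omega) hkl h2.le (hχV k h1 (by omega) hw)) w' hw'
  · intro k h1 h2 v hv w hw
    exact horth k h1 h2 v (hmono' 1 k le_rfl h1 h2.le hv) w hw
  · intro k h1 h2 w hw z hz
    exact (Submodule.mem_orthogonal _ _).1 hz w
      (hmono' (k + 1) q (by omega) h2 le_rfl (hχV k h1 h2 hw))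
  · intro v hv z hz
    exact (Submodule.mem_orthogonal _ _).1 hz v (hmono' 1 q le_rfl (by omega) le_rfl hv)
end

section
/- (Theorem 6.11 of the paper, matrix form.) The matrix R satisfies R πᵀ = Id_m and A = R A' Rᵀ; moreover, for every b ∈ ℝ^m, the vector x = Rᵀ b is the unique minimizer of xᵀ A' x over x ∈ ℝ^n subject to the constraint π x = b. -/
open scoped Matrix

theorem stmt4 {m n : ℕ} (hmn : m ≤ n)
    (Θ' : Matrix (Fin n) (Fin n) ℝ) (hΘ' : Θ'.PosDef)
    (pim : Matrix (Fin m) (Fin n) ℝ) (hrank : pim.rank = m)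
    (Θ : Matrix (Fin m) (Fin m) ℝ) (hΘ : Θ = pim * Θ' * pimᵀ)
    (A : Matrix (Fin m) (Fin m) ℝ) (hA : A = Θ⁻¹)
    (A' : Matrix (Fin n) (Fin n) ℝ) (hA' : A' = Θ'⁻¹)
    (R : Matrix (Fin m) (Fin n) ℝ) (hR : R = A * pim * Θ') :
    R * pimᵀ = 1 ∧
    A = R * A' * Rᵀ ∧
    ∀ b : Fin m → ℝ,
      pim.mulVec ((Rᵀ).mulVec b) = b ∧
      (∀ x : Fin n → ℝ, pim.mulVec x = b →
        ((Rᵀ).mulVec b) ⬝ᵥ A'.mulVec ((Rᵀ).mulVec b) ≤ x ⬝ᵥ A'.mulVec x) ∧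
      (∀ x : Fin n → ℝ, pim.mulVec x = b →
        x ⬝ᵥ A'.mulVec x = ((Rᵀ).mulVec b) ⬝ᵥ A'.mulVec ((Rᵀ).mulVec b) →
        x = (Rᵀ).mulVec b) := by
  have hinj : Function.Injective pim.vecMul := by
    rw [Matrix.vecMul_injective_iff, linearIndependent_iff_card_eq_finrank_span, Set.finrank,
      ← Matrix.rank_eq_finrank_span_row, hrank, Fintype.card_fin]
  have hΘpd : Θ.PosDef := by
    have h := hΘ'.mul_mul_conjTranspose_same hinj
    rw [Matrix.conjTranspose_eq_transpose_of_trivial] at h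
    rw [hΘ]; exact h
  have hu : IsUnit Θ.det := (Matrix.isUnit_iff_isUnit_det _).1 hΘpd.isUnit
  have hu' : IsUnit Θ'.det := (Matrix.isUnit_iff_isUnit_det _).1 hΘ'.isUnit
  have h1 : R * pimᵀ = 1 := by
    rw [hR, Matrix.mul_assoc, Matrix.mul_assoc, ← Matrix.mul_assoc pim, ← hΘ, hA,
      Matrix.nonsing_inv_mul _ hu]
  have h1t : pim * Rᵀ = 1 := by
    have h := congrArg Matrix.transpose h1
    simpa [Matrix.transpose_mul] using h
  have hRA : R * A' = A * pim := by
    rw [hR, hA', Matrix.mul_assoc, Matrix.mul_nonsing_inv _ hu', Matrix.mul_one]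
  have hpd : A'.PosDef := by rw [hA']; exact hΘ'.inv
  have hsym : A'ᵀ = A' := by
    have h := hpd.isHermitian.eq
    rwa [Matrix.conjTranspose_eq_transpose_of_trivial] at h
  have hAR : A' * Rᵀ = pimᵀ * Aᵀ := by
    have h := congrArg Matrix.transpose hRA
    rwa [Matrix.transpose_mul, Matrix.transpose_mul, hsym] at h
  refine ⟨h1, by rw [hRA, Matrix.mul_assoc, h1t, Matrix.mul_one], fun b => ?_⟩
  have hy : pim.mulVec ((Rᵀ).mulVec b) = b := by
    rw [Matrix.mulVec_mulVec, h1t, Matrix.one_mulVec]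
  have key : ∀ x : Fin n → ℝ, pim.mulVec x = b →
      x ⬝ᵥ A'.mulVec x = ((Rᵀ).mulVec b) ⬝ᵥ A'.mulVec ((Rᵀ).mulVec b)
        + (x - (Rᵀ).mulVec b) ⬝ᵥ A'.mulVec (x - (Rᵀ).mulVec b) := by
    intro x hx
    have hd : pim.mulVec (x - (Rᵀ).mulVec b) = 0 := by
      rw [Matrix.mulVec_sub, hx, hy, sub_self]
    have hc : (x - (Rᵀ).mulVec b) ⬝ᵥ A'.mulVec ((Rᵀ).mulVec b) = 0 := by
      rw [Matrix.mulVec_mulVec, hAR, ← Matrix.mulVec_mulVec, Matrix.dotProduct_mulVec,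
        Matrix.vecMul_transpose, hd, zero_dotProduct]
    have hs : ((Rᵀ).mulVec b) ⬝ᵥ A'.mulVec x = x ⬝ᵥ A'.mulVec ((Rᵀ).mulVec b) := by
      rw [Matrix.dotProduct_mulVec, ← Matrix.mulVec_transpose, hsym, dotProduct_comm]
    rw [sub_dotProduct] at hc
    rw [Matrix.mulVec_sub, sub_dotProduct, dotProduct_sub, dotProduct_sub]
    linarith
  refine ⟨hy, fun x hx => ?_, fun x hx he => ?_⟩
  · have h := hpd.posSemidef.dotProduct_mulVec_nonneg (x - (Rᵀ).mulVec b)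
    rw [star_trivial] at h
    linarith [key x hx]
  · by_contra hne
    have h := hpd.dotProduct_mulVec_pos (sub_ne_zero.2 hne)
    rw [star_trivial] at h
    linarith [key x hx]
end

section
/- (Theorem 2.2 of the paper: approximate eigenspace localization.) For every C_∂ ≥ 1 there exist constants c, C > 0 depending only on C_∂ such that whenever Condition(C_∂,H) holds: for every nonzero v ∈ V^(1), c H² ≤ λ_min(A) · (vᵀ A v)/|A v|² ≤ C; and for every 2 ≤ k ≤ q and every nonzero v ∈ 𝔚^(k), c H^{2k} ≤ λ_min(A) · (vᵀ A v)/|A v|² ≤ C H^{2k−2}. -/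
open scoped Matrix

/-- Cauchy-Schwarz in the energy norm. -/
theorem aux_cs {n : ℕ} (A : Matrix (Fin n) (Fin n) ℝ) (hA : A.PosDef) (x : Fin n → ℝ) :
    (x ⬝ᵥ x) ^ 2 ≤ (x ⬝ᵥ (A⁻¹).mulVec x) * (x ⬝ᵥ A.mulVec x) := by
  have hdet : IsUnit A.det := (Matrix.isUnit_iff_isUnit_det A).1 hA.isUnit
  have hT : Aᵀ = A := by
    have := hA.isHermitian
    rwa [Matrix.IsHermitian, Matrix.conjTranspose_eq_transpose_of_trivial] at this
  have hAB : A.mulVec ((A⁻¹).mulVec x) = x := by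
    rw [Matrix.mulVec_mulVec, Matrix.mul_nonsing_inv A hdet, Matrix.one_mulVec]
  have h := discrim_le_zero (a := x ⬝ᵥ A.mulVec x) (b := 2 * (x ⬝ᵥ x))
    (c := x ⬝ᵥ (A⁻¹).mulVec x) (fun s => by
      have h0 := hA.posSemidef.dotProduct_mulVec_nonneg ((A⁻¹).mulVec x + s • x)
      have h1 : (A⁻¹).mulVec x ⬝ᵥ A.mulVec x = x ⬝ᵥ x := by
        rw [Matrix.dotProduct_mulVec, ← Matrix.mulVec_transpose, hT, hAB]
      have h2 : (A⁻¹).mulVec x ⬝ᵥ x = x ⬝ᵥ (A⁻¹).mulVec x := dotProduct_comm _ _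
      simp only [star_trivial, Matrix.mulVec_add, Matrix.mulVec_smul, add_dotProduct,
        dotProduct_add, smul_dotProduct, dotProduct_smul, hAB, h1, h2, smul_eq_mul] at h0
      linarith)
  rw [discrim] at h
  nlinarith

theorem aux_cs' {n : ℕ} (x y : Fin n → ℝ) : (x ⬝ᵥ y) ^ 2 ≤ (x ⬝ᵥ x) * (y ⬝ᵥ y) := by
  have := Finset.sum_mul_sq_le_sq_mul_sq Finset.univ x y
  simpa [dotProduct, sq] using this

theorem aux_pos {n : ℕ} (x : Fin n → ℝ) (hx : x ≠ 0) : 0 < x ⬝ᵥ x := by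
  have := Matrix.dotProduct_star_self_pos_iff.2 hx
  simpa using this

theorem aux_bd {n : ℕ} (B : Matrix (Fin n) (Fin n) ℝ) :
    ∃ M : ℝ, 0 < M ∧ ∀ x : Fin n → ℝ, x ⬝ᵥ B.mulVec x ≤ M * (x ⬝ᵥ x) := by
  refine ⟨(∑ i, ∑ j, |B i j|) + 1, by positivity, fun x => ?_⟩
  have hxx : 0 ≤ x ⬝ᵥ x := by simpa using dotProduct_star_self_nonneg x
  have hi : ∀ i, x i ^ 2 ≤ x ⬝ᵥ x := fun i => by
    rw [dotProduct, sq]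
    exact Finset.single_le_sum (f := fun i => x i * x i)
      (fun i _ => mul_self_nonneg (x i)) (Finset.mem_univ i)
  have h : x ⬝ᵥ B.mulVec x ≤ (∑ i, ∑ j, |B i j|) * (x ⬝ᵥ x) := by
    rw [dotProduct]
    rw [Finset.sum_mul]
    refine Finset.sum_le_sum fun i _ => ?_
    rw [Finset.sum_mul, Matrix.mulVec, dotProduct, Finset.mul_sum]
    refine Finset.sum_le_sum fun j _ => ?_
    have h1 : |x i * x j| ≤ x ⬝ᵥ x := by
      rw [abs_le]
      constructor <;> nlinarith [hi i, hi j, sq_nonneg (x i + x j), sq_nonneg (x i - x j)]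
    calc x i * (B i j * x j) = B i j * (x i * x j) := by ring
      _ ≤ |B i j * (x i * x j)| := le_abs_self _
      _ = |B i j| * |x i * x j| := abs_mul _ _
      _ ≤ |B i j| * (x ⬝ᵥ x) := by gcongr
  linarith

theorem aux_lmin {n : ℕ} (A : Matrix (Fin n) (Fin n) ℝ) (hA : A.PosDef) (l : ℝ)
    (hl : IsGreatest {t : ℝ | ∀ x : Fin n → ℝ, t * (x ⬝ᵥ x) ≤ x ⬝ᵥ A.mulVec x} l) :
    0 < l := by
  obtain ⟨M, hM, hB⟩ := aux_bd A⁻¹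
  refine lt_of_lt_of_le (inv_pos.2 hM) (hl.2 fun x => ?_)
  by_cases hx : x = 0
  · simp [hx]
  have hp := aux_pos x hx
  have hq : 0 ≤ x ⬝ᵥ A.mulVec x := by
    simpa using hA.posSemidef.dotProduct_mulVec_nonneg x
  have h1 := aux_cs A hA x
  have h2 := mul_le_mul_of_nonneg_right (hB x) hq
  rw [inv_mul_le_iff₀ hM]
  have : (x ⬝ᵥ x) * (x ⬝ᵥ x) ≤ (x ⬝ᵥ x) * (M * (x ⬝ᵥ A.mulVec x)) := by nlinarith
  exact le_of_mul_le_mul_left this hp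

/-- Lower bound, from condition (i) with `h = Hp ^ k`. -/
theorem aux_lower {n : ℕ} (A : Matrix (Fin n) (Fin n) ℝ) (hA : A.PosDef) (l Cd h : ℝ)
    (hl : 0 < l) (hC : 0 < Cd) (hh : 0 < h) (v : Fin n → ℝ) (hf : A.mulVec v ≠ 0)
    (H : h / (Cd * Real.sqrt l) ≤ Real.sqrt (A.mulVec v ⬝ᵥ (A⁻¹).mulVec (A.mulVec v)) /
      Real.sqrt (A.mulVec v ⬝ᵥ A.mulVec v)) :
    (1 / Cd ^ 2) * h ^ 2 ≤ l * (v ⬝ᵥ A.mulVec v) / (A.mulVec v ⬝ᵥ A.mulVec v) := by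
  have hdet : IsUnit A.det := (Matrix.isUnit_iff_isUnit_det A).1 hA.isUnit
  rw [Matrix.mulVec_mulVec, Matrix.nonsing_inv_mul A hdet, Matrix.one_mulVec,
    dotProduct_comm _ v] at H
  have hp := aux_pos _ hf
  have hq : 0 ≤ v ⬝ᵥ A.mulVec v := by
    simpa using hA.posSemidef.dotProduct_mulVec_nonneg v
  have H2 := pow_le_pow_left₀ (by positivity) H 2
  rw [div_pow, div_pow, mul_pow, Real.sq_sqrt hl.le, Real.sq_sqrt hq, Real.sq_sqrt hp.le,
    div_le_div_iff₀ (by positivity) hp] at H2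
  rw [le_div_iff₀ hp, div_mul_eq_mul_div, div_mul_eq_mul_div, div_le_iff₀ (by positivity)]
  linarith

/-- From `l|v|² ≤ K |v|_A²` deduce `l |v|_A² ≤ K |Av|²`. -/
theorem aux_upper {n : ℕ} (A : Matrix (Fin n) (Fin n) ℝ) (hA : A.PosDef) (l K : ℝ)
    (hl : 0 < l) (v : Fin n → ℝ) (hv : v ≠ 0) (hf : A.mulVec v ≠ 0)
    (H : l * (v ⬝ᵥ v) ≤ K * (v ⬝ᵥ A.mulVec v)) :
    l * (v ⬝ᵥ A.mulVec v) / (A.mulVec v ⬝ᵥ A.mulVec v) ≤ K := by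
  have hp := aux_pos _ hf
  have hq : 0 < v ⬝ᵥ A.mulVec v := by
    simpa using hA.dotProduct_mulVec_pos hv
  have h := aux_cs' v (A.mulVec v)
  rw [div_le_iff₀ hp]
  refine le_of_mul_le_mul_left (a := v ⬝ᵥ A.mulVec v) ?_ hq
  have h1 := mul_le_mul_of_nonneg_left h hl.le
  have h2 := mul_le_mul_of_nonneg_right H hp.le
  nlinarith

theorem aux_ker {n : ℕ} (A : Matrix (Fin n) (Fin n) ℝ) (hA : A.PosDef) (l K : ℝ)
    (hl : 0 < l) (v : Fin n → ℝ) (hv : v ≠ 0)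
    (H : Real.sqrt (v ⬝ᵥ (A⁻¹).mulVec v) / Real.sqrt (v ⬝ᵥ v) ≤ K / Real.sqrt l) :
    l * (v ⬝ᵥ v) ≤ K ^ 2 * (v ⬝ᵥ A.mulVec v) := by
  have hp := aux_pos _ hv
  have hq : 0 < v ⬝ᵥ A.mulVec v := by
    simpa using hA.dotProduct_mulVec_pos hv
  have hq' : 0 ≤ v ⬝ᵥ (A⁻¹).mulVec v := by
    simpa using hA.inv.posSemidef.dotProduct_mulVec_nonneg v
  have H2 := pow_le_pow_left₀ (by positivity) H 2
  rw [div_pow, div_pow, Real.sq_sqrt hl.le, Real.sq_sqrt hq', Real.sq_sqrt hp.le,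
    div_le_div_iff₀ hp hl] at H2
  have h1 := mul_le_mul_of_nonneg_left (aux_cs A hA v) hl.le
  have h2 := mul_le_mul_of_nonneg_right H2 hq.le
  refine le_of_mul_le_mul_left (a := v ⬝ᵥ v) ?_ hp
  nlinarith

theorem stmt5 (Cd : ℝ) (hCd : 1 ≤ Cd) :
    ∃ c C : ℝ, 0 < c ∧ 0 < C ∧
      ∀ (q : ℕ), 1 ≤ q →
      ∀ (d : ℕ → ℕ), (∀ k, 1 ≤ k → k ≤ q → 0 < d k) →
      ∀ (A : Matrix (Fin (d q)) (Fin (d q)) ℝ), A.PosDef →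
      ∀ (pim : ∀ k : ℕ, Matrix (Fin (d k)) (Fin (d (k + 1))) ℝ),
        (∀ k, 1 ≤ k → k < q → pim k * (pim k)ᵀ = 1) →
      ∀ (pikq : ∀ k : ℕ, Matrix (Fin (d k)) (Fin (d q)) ℝ),
        pikq q = 1 →
        (∀ k, 1 ≤ k → k < q → pikq k = pim k * pikq (k + 1)) →
      ∀ (lminA : ℝ),
        IsGreatest {t : ℝ | ∀ x : Fin (d q) → ℝ, t * (x ⬝ᵥ x) ≤ x ⬝ᵥ A.mulVec x} lminA →
      ∀ (Hp : ℝ), 0 < Hp → Hp < 1 →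
        (∀ k, 1 ≤ k → k ≤ q → ∀ x : Fin (d q) → ℝ,
          (∃ y : Fin (d k) → ℝ, x = ((pikq k)ᵀ).mulVec y) → x ≠ 0 →
          Hp ^ k / (Cd * Real.sqrt lminA) ≤
            Real.sqrt (x ⬝ᵥ (A⁻¹).mulVec x) / Real.sqrt (x ⬝ᵥ x)) →
        (∀ k, 1 ≤ k → k < q → ∀ x : Fin (d q) → ℝ,
          (pikq k).mulVec x = 0 → x ≠ 0 →
          Real.sqrt (x ⬝ᵥ (A⁻¹).mulVec x) / Real.sqrt (x ⬝ᵥ x) ≤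
            Cd * Hp ^ k / Real.sqrt lminA) →
        ((∀ v : Fin (d q) → ℝ, v ≠ 0 →
            (∃ y : Fin (d 1) → ℝ, A.mulVec v = ((pikq 1)ᵀ).mulVec y) →
            c * Hp ^ 2 ≤ lminA * (v ⬝ᵥ A.mulVec v) / (A.mulVec v ⬝ᵥ A.mulVec v) ∧
              lminA * (v ⬝ᵥ A.mulVec v) / (A.mulVec v ⬝ᵥ A.mulVec v) ≤ C) ∧
          (∀ k, 1 ≤ k → k < q → ∀ v : Fin (d q) → ℝ, v ≠ 0 →
            (∃ y : Fin (d (k + 1)) → ℝ, A.mulVec v = ((pikq (k + 1))ᵀ).mulVec y) →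
            (∀ w : Fin (d q) → ℝ,
              (∃ y : Fin (d k) → ℝ, A.mulVec w = ((pikq k)ᵀ).mulVec y) →
              w ⬝ᵥ A.mulVec v = 0) →
            c * Hp ^ (2 * (k + 1)) ≤
                lminA * (v ⬝ᵥ A.mulVec v) / (A.mulVec v ⬝ᵥ A.mulVec v) ∧
              lminA * (v ⬝ᵥ A.mulVec v) / (A.mulVec v ⬝ᵥ A.mulVec v) ≤
                C * Hp ^ (2 * k))) := by
  have hC0 : 0 < Cd := by linarith
  refine ⟨1 / Cd ^ 2, Cd ^ 2, by positivity, by positivity, ?_⟩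
  intro q hq d hd A hA pim hpim pikq hpq hrec l hl Hp hH0 hH1 hi hii
  have hl0 := aux_lmin A hA l hl
  have hdet : IsUnit A.det := (Matrix.isUnit_iff_isUnit_det A).1 hA.isUnit
  have hT : Aᵀ = A := by
    have := hA.isHermitian
    rwa [Matrix.IsHermitian, Matrix.conjTranspose_eq_transpose_of_trivial] at this
  have hne : ∀ v : Fin (d q) → ℝ, v ≠ 0 → A.mulVec v ≠ 0 := by
    intro v hv h
    have := hA.dotProduct_mulVec_pos hv
    simp [h] at this
  refine ⟨fun v hv hy => ⟨?_, ?_⟩, fun k hk hkq v hv hy hw => ⟨?_, ?_⟩⟩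
  · have := aux_lower A hA l Cd (Hp ^ 1) hl0 hC0 (by positivity) v (hne v hv)
      (hi 1 le_rfl hq _ hy (hne v hv))
    simpa using this
  · refine aux_upper A hA l _ hl0 v hv (hne v hv) ?_
    have hq : 0 < v ⬝ᵥ A.mulVec v := by
      simpa using hA.dotProduct_mulVec_pos hv
    have := hl.1 v
    nlinarith [mul_nonneg (by nlinarith : 0 ≤ Cd ^ 2 - 1) hq.le]
  · have := aux_lower A hA l Cd (Hp ^ (k + 1)) hl0 hC0 (by positivity) v (hne v hv)
      (hi (k + 1) (by omega) hkq _ hy (hne v hv))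
    rwa [← pow_mul, mul_comm (k + 1) 2] at this
  · have hker : (pikq k).mulVec v = 0 := by
      refine dotProduct_eq_zero _ fun y => ?_
      have hAB : A.mulVec ((A⁻¹).mulVec (((pikq k)ᵀ).mulVec y)) = ((pikq k)ᵀ).mulVec y := by
        rw [Matrix.mulVec_mulVec, Matrix.mul_nonsing_inv A hdet, Matrix.one_mulVec]
      have := hw ((A⁻¹).mulVec (((pikq k)ᵀ).mulVec y)) ⟨y, hAB⟩
      rw [Matrix.dotProduct_mulVec, ← Matrix.mulVec_transpose, hT, hAB,
        Matrix.mulVec_transpose, ← Matrix.dotProduct_mulVec] at this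
      rw [dotProduct_comm]
      exact this
    have h := aux_upper A hA l _ hl0 v hv (hne v hv)
      (aux_ker A hA l _ hl0 v hv (hii k hk hkq v hker hv))
    rwa [mul_pow, ← pow_mul, mul_comm k 2] at h
end

section
/- (Theorem 2.3 of the paper: accuracy of the gamblet solve.) For b ∈ ℝ^N let u := A⁻¹ b and let u^(k) denote the A-orthogonal projection of u onto V^(k) (projection with respect to ⟨u,v⟩_A := uᵀAv). Then u^(q) = u, and for every C_∂ ≥ 1 there exists a constant C depending only on C_∂ such that whenever Condition(C_∂,H) holds, for every b ∈ ℝ^N and every 1 ≤ k ≤ q−1: |u − u^(k)|_A ≤ (C/√(λ_min(A))) H^k |b|. -/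
open scoped Matrix

theorem pikq_orth (q : ℕ) (d : ℕ → ℕ)
    (pim : ∀ k : ℕ, Matrix (Fin (d k)) (Fin (d (k + 1))) ℝ)
    (hpim : ∀ k, 1 ≤ k → k < q → pim k * (pim k)ᵀ = 1)
    (pikq : ∀ k : ℕ, Matrix (Fin (d k)) (Fin (d q)) ℝ)
    (hq : pikq q = 1)
    (hk : ∀ k, 1 ≤ k → k < q → pikq k = pim k * pikq (k + 1)) :
    ∀ j k, 1 ≤ k → k + j = q → pikq k * (pikq k)ᵀ = 1 := by
  intro j
  induction j with
  | zero =>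
    intro k _ h
    obtain rfl : k = q := by omega
    rw [hq]; simp
  | succ j ih =>
    intro k h1 h
    have h2 := ih (k + 1) (by omega) (by omega)
    rw [hk k h1 (by omega), Matrix.transpose_mul, Matrix.mul_assoc,
      ← Matrix.mul_assoc (pikq (k + 1)), h2, Matrix.one_mul, hpim k h1 (by omega)]

theorem stmt6 (Cd : ℝ) (hCd : 1 ≤ Cd) :
    ∃ C : ℝ, 0 < C ∧
      ∀ (q : ℕ), 1 ≤ q →
      ∀ (d : ℕ → ℕ), (∀ k, 1 ≤ k → k ≤ q → 0 < d k) →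
      ∀ (A : Matrix (Fin (d q)) (Fin (d q)) ℝ), A.PosDef →
      ∀ (pim : ∀ k : ℕ, Matrix (Fin (d k)) (Fin (d (k + 1))) ℝ),
        (∀ k, 1 ≤ k → k < q → pim k * (pim k)ᵀ = 1) →
      ∀ (pikq : ∀ k : ℕ, Matrix (Fin (d k)) (Fin (d q)) ℝ),
        pikq q = 1 →
        (∀ k, 1 ≤ k → k < q → pikq k = pim k * pikq (k + 1)) →
      ∀ (lminA : ℝ),
        IsGreatest {t : ℝ | ∀ x : Fin (d q) → ℝ, t * (x ⬝ᵥ x) ≤ x ⬝ᵥ A.mulVec x} lminA →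
      ∀ (b u : Fin (d q) → ℝ), A.mulVec u = b →
        ((∀ uq : Fin (d q) → ℝ,
            (∃ y : Fin (d q) → ℝ, A.mulVec uq = ((pikq q)ᵀ).mulVec y) →
            (∀ w : Fin (d q) → ℝ,
              (∃ y : Fin (d q) → ℝ, A.mulVec w = ((pikq q)ᵀ).mulVec y) →
              (u - uq) ⬝ᵥ A.mulVec w = 0) →
            uq = u) ∧
          (∀ (Hp : ℝ), 0 < Hp → Hp < 1 →
            (∀ k, 1 ≤ k → k ≤ q → ∀ x : Fin (d q) → ℝ,
              (∃ y : Fin (d k) → ℝ, x = ((pikq k)ᵀ).mulVec y) → x ≠ 0 →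
              Hp ^ k / (Cd * Real.sqrt lminA) ≤
                Real.sqrt (x ⬝ᵥ (A⁻¹).mulVec x) / Real.sqrt (x ⬝ᵥ x)) →
            (∀ k, 1 ≤ k → k < q → ∀ x : Fin (d q) → ℝ,
              (pikq k).mulVec x = 0 → x ≠ 0 →
              Real.sqrt (x ⬝ᵥ (A⁻¹).mulVec x) / Real.sqrt (x ⬝ᵥ x) ≤
                Cd * Hp ^ k / Real.sqrt lminA) →
            ∀ k, 1 ≤ k → k < q → ∀ uk : Fin (d q) → ℝ,
              (∃ y : Fin (d k) → ℝ, A.mulVec uk = ((pikq k)ᵀ).mulVec y) →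
              (∀ w : Fin (d q) → ℝ,
                (∃ y : Fin (d k) → ℝ, A.mulVec w = ((pikq k)ᵀ).mulVec y) →
                (u - uk) ⬝ᵥ A.mulVec w = 0) →
              Real.sqrt ((u - uk) ⬝ᵥ A.mulVec (u - uk)) ≤
                C / Real.sqrt lminA * Hp ^ k * Real.sqrt (b ⬝ᵥ b))) := by
  refine ⟨Cd, by linarith, ?_⟩
  intro q _ d _ A hA pim hpim pikq hqq hrec lminA _ b u hu
  have hunit : IsUnit A.det := (Matrix.isUnit_iff_isUnit_det A).1 hA.isUnit
  have hAT : Aᵀ = A := by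
    have := hA.1.eq
    rwa [Matrix.conjTranspose_eq_transpose_of_trivial] at this
  have hsymm : ∀ x y : Fin (d q) → ℝ, x ⬝ᵥ A.mulVec y = y ⬝ᵥ A.mulVec x := by
    intro x y
    rw [Matrix.dotProduct_mulVec, ← Matrix.mulVec_transpose, hAT, dotProduct_comm]
  have hnn : ∀ x : Fin (d q) → ℝ, 0 ≤ x ⬝ᵥ A.mulVec x := by
    intro x
    simpa using hA.posSemidef.dotProduct_mulVec_nonneg x
  constructor
  · intro uq _ h
    have h0 := h (u - uq) ⟨A.mulVec (u - uq), by rw [hqq]; simp⟩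
    by_contra hne
    have hne' : u - uq ≠ 0 := fun h => hne (sub_eq_zero.1 h).symm
    have := hA.dotProduct_mulVec_pos hne'
    simp only [star_trivial] at this
    linarith
  · intro Hp hH0 _ _ hii k hk1 hkq uk ⟨y, hy⟩ horth
    have hP := pikq_orth q d pim hpim pikq hqq hrec (q - k) k hk1 (by omega)
    have hii' := hii k hk1 hkq
    generalize pikq k = P at *
    obtain ⟨x, hx⟩ : ∃ x, x = b - Pᵀ.mulVec (P.mulVec b) := ⟨_, rfl⟩
    have hPx : P.mulVec x = 0 := by
      rw [hx, Matrix.mulVec_sub, Matrix.mulVec_mulVec, hP, Matrix.one_mulVec, sub_self]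
    obtain ⟨v, hv⟩ : ∃ v, v = (A⁻¹).mulVec x := ⟨_, rfl⟩
    have hAv : A.mulVec v = x := by
      rw [hv, Matrix.mulVec_mulVec, Matrix.mul_nonsing_inv _ hunit, Matrix.one_mulVec]
    have h1 := horth (u - v - uk) ⟨P.mulVec b - y, by
      rw [Matrix.mulVec_sub, Matrix.mulVec_sub, hu, hAv, hy, Matrix.mulVec_sub, hx]; simp⟩
    obtain ⟨e, he⟩ : ∃ e, e = u - uk := ⟨_, rfl⟩
    have h2 : u - v - uk = e - v := by rw [he]; abel
    rw [h2, ← he, Matrix.mulVec_sub, dotProduct_sub] at h1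
    rw [← he]
    have h3 := hnn (v - e)
    rw [Matrix.mulVec_sub, dotProduct_sub, sub_dotProduct, sub_dotProduct, hsymm v e] at h3
    have h4 : e ⬝ᵥ A.mulVec e ≤ x ⬝ᵥ (A⁻¹).mulVec x := by
      rw [← hv, dotProduct_comm x v, ← hAv]; linarith
    have hxx : x ⬝ᵥ x ≤ b ⬝ᵥ b := by
      have hb : b = x + Pᵀ.mulVec (P.mulVec b) := by rw [hx]; abel
      have h5 : x ⬝ᵥ Pᵀ.mulVec (P.mulVec b) = 0 := by
        rw [Matrix.dotProduct_mulVec, Matrix.vecMul_transpose, hPx, zero_dotProduct]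
      have h6 : 0 ≤ Pᵀ.mulVec (P.mulVec b) ⬝ᵥ Pᵀ.mulVec (P.mulVec b) :=
        Finset.sum_nonneg fun i _ => mul_self_nonneg _
      generalize Pᵀ.mulVec (P.mulVec b) = z at *
      rw [hb, add_dotProduct, dotProduct_add, dotProduct_add, dotProduct_comm z x, h5]
      linarith
    have hc : 0 ≤ Cd / Real.sqrt lminA * Hp ^ k := by positivity
    refine (Real.sqrt_le_sqrt h4).trans ?_
    refine le_trans ?_ (mul_le_mul_of_nonneg_left (Real.sqrt_le_sqrt hxx) hc)
    by_cases hx0 : x = 0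
    · simp [hx0]
    · have h7 := hii' x hPx hx0
      have h8 : 0 < x ⬝ᵥ x := by
        refine lt_of_le_of_ne (Finset.sum_nonneg fun i _ => mul_self_nonneg _) ?_
        intro h
        exact hx0 (dotProduct_self_eq_zero.1 h.symm)
      rw [div_le_iff₀ (Real.sqrt_pos.2 h8)] at h7
      refine h7.trans (le_of_eq ?_)
      ring
end

section
/- (Theorem 2.4 of the paper: uniformly bounded condition numbers.) For every C_∂ ≥ 1 there exists a constant C depending only on C_∂ such that whenever Condition(C_∂,H) holds: C⁻¹ Id ≼ A^(1)/λ_min(A) ≼ C H⁻² Id and Cond(A^(1)) ≤ C H⁻²; and for every 2 ≤ k ≤ q: C⁻¹ H^{−2(k−1)} Id ≼ B^(k)/λ_min(A) ≼ C H^{−2k} Id and Cond(B^(k)) ≤ C H⁻². Here ≼ denotes the Loewner (positive semidefinite) order and Cond(M) := λ_max(M)/λ_min(M) for a symmetric positive definite matrix M. -/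
open scoped Matrix

namespace Stmt7Aux

variable {m n : Type*} [Fintype m] [Fintype n] [DecidableEq m] [DecidableEq n]

lemma dp_nonneg (x : n → ℝ) : 0 ≤ x ⬝ᵥ x :=
  Finset.sum_nonneg fun i _ => mul_self_nonneg (x i)

lemma dp_pos {x : n → ℝ} (hx : x ≠ 0) : 0 < x ⬝ᵥ x :=
  lt_of_le_of_ne (dp_nonneg x) fun h => hx (dotProduct_self_eq_zero.mp h.symm)

lemma quad_pos {A : Matrix n n ℝ} (hA : A.PosDef) {x : n → ℝ} (hx : x ≠ 0) :
    0 < x ⬝ᵥ A.mulVec x := by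
  simpa using hA.dotProduct_mulVec_pos hx

lemma quad_nonneg {A : Matrix n n ℝ} (hA : A.PosDef) (x : n → ℝ) :
    0 ≤ x ⬝ᵥ A.mulVec x := by
  by_cases hx : x = 0
  · simp [hx]
  · exact (quad_pos hA hx).le

lemma symm_dp {A : Matrix n n ℝ} (hA : A.PosDef) (x y : n → ℝ) :
    x ⬝ᵥ A.mulVec y = y ⬝ᵥ A.mulVec x := by
  have h : Aᵀ = A := by simpa using hA.1.eq
  rw [Matrix.dotProduct_mulVec, ← Matrix.mulVec_transpose, h, dotProduct_comm]

lemma mulVec_inv {A : Matrix n n ℝ} (hA : A.PosDef) (x : n → ℝ) :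
    A.mulVec (A⁻¹.mulVec x) = x := by
  have h : IsUnit A.det := (Matrix.isUnit_iff_isUnit_det A).mp hA.isUnit
  rw [Matrix.mulVec_mulVec, Matrix.mul_nonsing_inv A h, Matrix.one_mulVec]

lemma cs {A : Matrix n n ℝ} (hA : A.PosDef) (x y : n → ℝ) :
    (x ⬝ᵥ A.mulVec y) ^ 2 ≤ (x ⬝ᵥ A.mulVec x) * (y ⬝ᵥ A.mulVec y) := by
  have h : ∀ t : ℝ, 0 ≤ (x ⬝ᵥ A.mulVec x) * (t * t) + (2 * (x ⬝ᵥ A.mulVec y)) * t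
      + y ⬝ᵥ A.mulVec y := by
    intro t
    have := quad_nonneg hA (t • x + y)
    simp only [Matrix.mulVec_add, Matrix.mulVec_smul, add_dotProduct, dotProduct_add,
      smul_dotProduct, dotProduct_smul, smul_eq_mul] at this
    rw [symm_dp hA y x] at this
    linarith
  have := discrim_le_zero h
  unfold discrim at this
  nlinarith

lemma cs_inv {A : Matrix n n ℝ} (hA : A.PosDef) (x : n → ℝ) :
    (x ⬝ᵥ x) ^ 2 ≤ (x ⬝ᵥ A.mulVec x) * (x ⬝ᵥ A⁻¹.mulVec x) := by
  have := cs hA x (A⁻¹.mulVec x)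
  rw [mulVec_inv hA, dotProduct_comm (A⁻¹.mulVec x) x] at this
  exact this

lemma quad_bound (M : Matrix n n ℝ) : ∃ K : ℝ, 0 < K ∧ ∀ x : n → ℝ,
    x ⬝ᵥ M.mulVec x ≤ K * (x ⬝ᵥ x) := by
  refine ⟨(∑ i, ∑ j, |M i j|) + 1, by positivity, fun x => ?_⟩
  have h1 : ∀ i, x i ^ 2 ≤ x ⬝ᵥ x := by
    intro i
    rw [pow_two]
    exact Finset.single_le_sum (f := fun i => x i * x i)
      (fun i _ => mul_self_nonneg (x i)) (Finset.mem_univ i)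
  have h2 : x ⬝ᵥ M.mulVec x ≤ (∑ i, ∑ j, |M i j|) * (x ⬝ᵥ x) := by
    have e : x ⬝ᵥ M.mulVec x = ∑ i, ∑ j, x i * (M i j * x j) := by
      simp only [dotProduct, Matrix.mulVec, Finset.mul_sum]
    rw [e, Finset.sum_mul]
    refine Finset.sum_le_sum fun i _ => ?_
    rw [Finset.sum_mul]
    refine Finset.sum_le_sum fun j _ => ?_
    have h3 : |x i * x j| ≤ x ⬝ᵥ x := by
      rw [abs_mul]
      have := h1 i
      have := h1 j
      nlinarith [sq_nonneg (|x i| - |x j|), sq_abs (x i), sq_abs (x j)]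
    calc x i * (M i j * x j) = M i j * (x i * x j) := by ring
      _ ≤ |M i j * (x i * x j)| := le_abs_self _
      _ = |M i j| * |x i * x j| := abs_mul _ _
      _ ≤ _ := mul_le_mul_of_nonneg_left h3 (abs_nonneg _)
  nlinarith [dp_nonneg x]

lemma lmin_pos {A : Matrix n n ℝ} (hA : A.PosDef) {l : ℝ}
    (hl : IsGreatest {t : ℝ | ∀ x : n → ℝ, t * (x ⬝ᵥ x) ≤ x ⬝ᵥ A.mulVec x} l) : 0 < l := by
  obtain ⟨K, hK, h⟩ := quad_bound A⁻¹
  refine lt_of_lt_of_le (inv_pos.mpr hK) (hl.2 fun x => ?_)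
  by_cases hx : x = 0
  · simp [hx]
  have h1 := cs_inv hA x
  have h2 := mul_le_mul_of_nonneg_left (h x) (quad_nonneg hA x)
  have h3 := dp_pos hx
  have h4 : x ⬝ᵥ x ≤ (x ⬝ᵥ A.mulVec x) * K := by
    refine le_of_mul_le_mul_right ?_ h3
    nlinarith
  rw [inv_mul_le_iff₀ hK]
  linarith

lemma contr {P : Matrix m n ℝ} (hP : P * Pᵀ = 1) (x : n → ℝ) :
    P.mulVec x ⬝ᵥ P.mulVec x ≤ x ⬝ᵥ x := by
  have h := dp_nonneg (x - Pᵀ.mulVec (P.mulVec x))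
  have e1 : x ⬝ᵥ Pᵀ.mulVec (P.mulVec x) = P.mulVec x ⬝ᵥ P.mulVec x := by
    rw [Matrix.dotProduct_mulVec, Matrix.vecMul_transpose]
  have e2 : Pᵀ.mulVec (P.mulVec x) ⬝ᵥ Pᵀ.mulVec (P.mulVec x) = P.mulVec x ⬝ᵥ P.mulVec x := by
    rw [Matrix.dotProduct_mulVec, Matrix.vecMul_transpose, Matrix.mulVec_mulVec, hP,
      Matrix.one_mulVec]
  rw [sub_dotProduct, dotProduct_sub, dotProduct_sub, e2,
    dotProduct_comm (Pᵀ.mulVec (P.mulVec x)) x, e1] at h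
  linarith

lemma isom {P : Matrix m n ℝ} (hP : P * Pᵀ = 1) (y : m → ℝ) :
    Pᵀ.mulVec y ⬝ᵥ Pᵀ.mulVec y = y ⬝ᵥ y := by
  rw [Matrix.dotProduct_mulVec, Matrix.vecMul_transpose, Matrix.mulVec_mulVec, hP,
      Matrix.one_mulVec]

lemma theta_quad (P : Matrix m n ℝ) (M : Matrix n n ℝ) (y : m → ℝ) :
    y ⬝ᵥ (P * M * Pᵀ).mulVec y = Pᵀ.mulVec y ⬝ᵥ M.mulVec (Pᵀ.mulVec y) := by
  rw [← Matrix.mulVec_mulVec, ← Matrix.mulVec_mulVec, Matrix.dotProduct_mulVec,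
    ← Matrix.mulVec_transpose]

lemma theta_pd {P : Matrix m n ℝ} (hP : P * Pᵀ = 1) {A : Matrix n n ℝ} (hA : A.PosDef) :
    (P * A⁻¹ * Pᵀ).PosDef := by
  have hi : (A⁻¹).PosDef := hA.inv
  have hs : (A⁻¹)ᵀ = A⁻¹ := by simpa using hi.1.eq
  refine Matrix.PosDef.of_dotProduct_mulVec_pos ?_ ?_
  · unfold Matrix.IsHermitian
    simp only [Matrix.conjTranspose_eq_transpose_of_trivial, Matrix.transpose_mul,
      Matrix.transpose_transpose, hs, Matrix.mul_assoc]
  · intro y hy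
    simp only [star_trivial]
    rw [theta_quad]
    refine quad_pos hi fun h => ?_
    have := isom hP y
    rw [h] at this
    have := dp_pos hy
    simp_all

lemma lift {P : Matrix m n ℝ} (hP : P * Pᵀ = 1) {A : Matrix n n ℝ} (hA : A.PosDef) (v : m → ℝ) :
    ∃ x : n → ℝ, P.mulVec x = v ∧
      x ⬝ᵥ A.mulVec x = v ⬝ᵥ ((P * A⁻¹ * Pᵀ)⁻¹).mulVec v := by
  have hT := theta_pd hP hA
  set u := ((P * A⁻¹ * Pᵀ)⁻¹).mulVec v with hu
  have e : P.mulVec (A⁻¹.mulVec (Pᵀ.mulVec u)) = v := by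
    have := mulVec_inv hT v
    rwa [← hu, ← Matrix.mulVec_mulVec, ← Matrix.mulVec_mulVec] at this
  refine ⟨A⁻¹.mulVec (Pᵀ.mulVec u), e, ?_⟩
  rw [mulVec_inv hA, Matrix.dotProduct_mulVec, Matrix.vecMul_transpose, e]

lemma upper {P : Matrix m n ℝ} (hP : P * Pᵀ = 1) {A : Matrix n n ℝ} (hA : A.PosDef) {C l h : ℝ}
    (hC : 0 < C) (hl : 0 < l) (hh : 0 < h)
    (H : ∀ x : n → ℝ, (∃ y : m → ℝ, x = Pᵀ.mulVec y) → x ≠ 0 →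
      h / (C * Real.sqrt l) ≤ Real.sqrt (x ⬝ᵥ (A⁻¹).mulVec x) / Real.sqrt (x ⬝ᵥ x))
    (v : m → ℝ) :
    h ^ 2 * (v ⬝ᵥ ((P * A⁻¹ * Pᵀ)⁻¹).mulVec v) ≤ C ^ 2 * (l * (v ⬝ᵥ v)) := by
  have hT := theta_pd hP hA
  set u := ((P * A⁻¹ * Pᵀ)⁻¹).mulVec v with hu
  have e : (P * A⁻¹ * Pᵀ).mulVec u = v := mulVec_inv hT v
  have h0 : h ^ 2 * (u ⬝ᵥ u) ≤ C ^ 2 * l * (v ⬝ᵥ u) := by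
    by_cases hz : Pᵀ.mulVec u = 0
    · have h1 := isom hP u
      rw [hz] at h1
      have h2 : u = 0 := dotProduct_self_eq_zero.mp (by simpa using h1.symm)
      simp [h2]
    have h1 := H _ ⟨u, rfl⟩ hz
    have hp := dp_pos hz
    have hq := theta_quad P A⁻¹ u
    rw [e, dotProduct_comm] at hq
    rw [← hq] at h1
    rw [isom hP u] at h1 hp
    have hvu : 0 ≤ v ⬝ᵥ u := by rw [hq]; exact quad_nonneg hA.inv _
    have h2 := pow_le_pow_left₀ (by positivity) h1 2
    rw [div_pow, div_pow, mul_pow, Real.sq_sqrt hl.le, Real.sq_sqrt hvu, Real.sq_sqrt hp.le,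
      div_le_div_iff₀ (by positivity) hp] at h2
    linarith
  by_cases hz : v ⬝ᵥ u = 0
  · rw [hz]; have := dp_nonneg v; simp only [mul_zero]; positivity
  have hvu : 0 < v ⬝ᵥ u := lt_of_le_of_ne (quad_nonneg hT.inv v) (Ne.symm hz)
  have hcs : (v ⬝ᵥ u) ^ 2 ≤ (v ⬝ᵥ v) * (u ⬝ᵥ u) := by
    have := cs (Matrix.PosDef.one (n := m) (R := ℝ)) v u
    simpa using this
  refine le_of_mul_le_mul_right ?_ hvu
  have h3 := mul_le_mul_of_nonneg_left h0 (dp_nonneg v)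
  have h4 := mul_le_mul_of_nonneg_left hcs (sq_nonneg h)
  nlinarith

lemma kerbound {A : Matrix n n ℝ} (hA : A.PosDef) {C l h : ℝ} (hl : 0 < l) (x : n → ℝ)
    (H : x ≠ 0 → Real.sqrt (x ⬝ᵥ (A⁻¹).mulVec x) / Real.sqrt (x ⬝ᵥ x) ≤ C * h / Real.sqrt l) :
    l * (x ⬝ᵥ x) ≤ C ^ 2 * (h ^ 2 * (x ⬝ᵥ A.mulVec x)) := by
  by_cases hx : x = 0
  · simp [hx]
  have hp := dp_pos hx
  have hi := quad_nonneg hA.inv x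
  have ha := quad_nonneg hA x
  have h2 := pow_le_pow_left₀ (by positivity) (H hx) 2
  rw [div_pow, div_pow, mul_pow, Real.sq_sqrt hl.le, Real.sq_sqrt hi, Real.sq_sqrt hp.le,
      div_le_div_iff₀ hp hl] at h2
  have h1 := cs_inv hA x
  refine le_of_mul_le_mul_right ?_ hp
  have h3 := mul_le_mul_of_nonneg_left h2 ha
  have h4 := mul_le_mul_of_nonneg_left h1 hl.le
  nlinarith

lemma condAux {l a b c d h g K : ℝ} (hl : 0 < l) (hg : 0 < g) (hK : 0 < K)
    (hc : 0 ≤ c) (hb : 0 ≤ b)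
    (h1 : g * h * a ≤ K * (l * b)) (h2 : l * d ≤ K * (g * c)) (hd : 0 ≤ d) :
    h * (a * d) ≤ K ^ 2 * (c * b) := by
  refine le_of_mul_le_mul_left ?_ (mul_pos hl hg)
  have h3 := mul_le_mul_of_nonneg_right h1 (mul_nonneg hl.le hd)
  have h4 := mul_le_mul_of_nonneg_left h2 (mul_nonneg hK.le (mul_nonneg hl.le hb))
  nlinarith

end Stmt7Aux

theorem stmt7 (Cd : ℝ) (hCd : 1 ≤ Cd) :
    ∃ C : ℝ, 0 < C ∧
      ∀ (q : ℕ), 2 ≤ q →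
      ∀ (d d' : ℕ → ℕ), (∀ k, 1 ≤ k → k ≤ q → 0 < d k) →
      ∀ (A : Matrix (Fin (d q)) (Fin (d q)) ℝ), A.PosDef →
      ∀ (pim : ∀ k : ℕ, Matrix (Fin (d k)) (Fin (d (k + 1))) ℝ),
        (∀ k, 1 ≤ k → k < q → pim k * (pim k)ᵀ = 1) →
      ∀ (pikq : ∀ k : ℕ, Matrix (Fin (d k)) (Fin (d q)) ℝ),
        pikq q = 1 →
        (∀ k, 1 ≤ k → k < q → pikq k = pim k * pikq (k + 1)) →
      ∀ (W : ∀ k : ℕ, Matrix (Fin (d' k)) (Fin (d k)) ℝ),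
        (∀ k, 1 ≤ k → k < q → d' (k + 1) = d (k + 1) - d k) →
        (∀ k, 1 ≤ k → k < q →
          LinearMap.range (Matrix.mulVecLin ((W (k + 1))ᵀ)) =
            LinearMap.ker (Matrix.mulVecLin (pim k))) →
        (∀ k, 1 ≤ k → k < q → W (k + 1) * (W (k + 1))ᵀ = 1) →
      ∀ (lminA : ℝ),
        IsGreatest {t : ℝ | ∀ x : Fin (d q) → ℝ, t * (x ⬝ᵥ x) ≤ x ⬝ᵥ A.mulVec x} lminA →
      ∀ (Hp : ℝ), 0 < Hp → Hp < 1 →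
        (∀ k, 1 ≤ k → k ≤ q → ∀ x : Fin (d q) → ℝ,
          (∃ y : Fin (d k) → ℝ, x = ((pikq k)ᵀ).mulVec y) → x ≠ 0 →
          Hp ^ k / (Cd * Real.sqrt lminA) ≤
            Real.sqrt (x ⬝ᵥ (A⁻¹).mulVec x) / Real.sqrt (x ⬝ᵥ x)) →
        (∀ k, 1 ≤ k → k < q → ∀ x : Fin (d q) → ℝ,
          (pikq k).mulVec x = 0 → x ≠ 0 →
          Real.sqrt (x ⬝ᵥ (A⁻¹).mulVec x) / Real.sqrt (x ⬝ᵥ x) ≤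
            Cd * Hp ^ k / Real.sqrt lminA) →
        ((∀ x : Fin (d 1) → ℝ,
            lminA * (x ⬝ᵥ x) ≤
              C * (x ⬝ᵥ ((pikq 1 * A⁻¹ * (pikq 1)ᵀ)⁻¹).mulVec x) ∧
            Hp ^ 2 * (x ⬝ᵥ ((pikq 1 * A⁻¹ * (pikq 1)ᵀ)⁻¹).mulVec x) ≤
              C * (lminA * (x ⬝ᵥ x))) ∧
          (∀ x y : Fin (d 1) → ℝ,
            Hp ^ 2 * ((x ⬝ᵥ ((pikq 1 * A⁻¹ * (pikq 1)ᵀ)⁻¹).mulVec x) * (y ⬝ᵥ y)) ≤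
              C * ((y ⬝ᵥ ((pikq 1 * A⁻¹ * (pikq 1)ᵀ)⁻¹).mulVec y) * (x ⬝ᵥ x))) ∧
          (∀ k, 1 ≤ k → k < q →
            (∀ z : Fin (d' (k + 1)) → ℝ,
              lminA * (z ⬝ᵥ z) ≤
                C * (Hp ^ (2 * k) *
                  (z ⬝ᵥ (W (k + 1) * (pikq (k + 1) * A⁻¹ * (pikq (k + 1))ᵀ)⁻¹ *
                    (W (k + 1))ᵀ).mulVec z)) ∧
              Hp ^ (2 * (k + 1)) *
                  (z ⬝ᵥ (W (k + 1) * (pikq (k + 1) * A⁻¹ * (pikq (k + 1))ᵀ)⁻¹ *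
                    (W (k + 1))ᵀ).mulVec z) ≤
                C * (lminA * (z ⬝ᵥ z))) ∧
            (∀ z w : Fin (d' (k + 1)) → ℝ,
              Hp ^ 2 *
                  ((z ⬝ᵥ (W (k + 1) * (pikq (k + 1) * A⁻¹ * (pikq (k + 1))ᵀ)⁻¹ *
                    (W (k + 1))ᵀ).mulVec z) * (w ⬝ᵥ w)) ≤
                C * ((w ⬝ᵥ (W (k + 1) * (pikq (k + 1) * A⁻¹ * (pikq (k + 1))ᵀ)⁻¹ *
                    (W (k + 1))ᵀ).mulVec w) * (z ⬝ᵥ z))))) := by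
  have hC0 : 0 < Cd := by linarith
  have hC2 : 1 ≤ Cd ^ 2 := one_le_pow₀ hCd
  have hC24 : Cd ^ 2 ≤ Cd ^ 4 := pow_le_pow_right₀ hCd (by norm_num)
  refine ⟨Cd ^ 4, by positivity, ?_⟩
  intro q hq d d' hd A hA pim hpim pikq hqq hrec W hd' hker hW lminA hl Hp hH0 hH1 hi hii
  have hlp := Stmt7Aux.lmin_pos hA hl
  have hP : ∀ j k, 1 ≤ k → k + j = q → pikq k * (pikq k)ᵀ = 1 := by
    intro j
    induction j with
    | zero =>
      intro k _ hk
      obtain rfl : k = q := by omega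
      rw [hqq]; simp
    | succ j ih =>
      intro k hk1 hk
      rw [hrec k hk1 (by omega), Matrix.transpose_mul, Matrix.mul_assoc,
        ← Matrix.mul_assoc (pikq (k + 1)), ih (k + 1) (by omega) (by omega), Matrix.one_mul,
        hpim k hk1 (by omega)]
  have hP' : ∀ k, 1 ≤ k → k ≤ q → pikq k * (pikq k)ᵀ = 1 := fun k h1 h2 =>
    hP (q - k) k h1 (by omega)
  have up : ∀ {a b : ℝ}, 0 ≤ b → a ≤ Cd ^ 2 * b → a ≤ Cd ^ 4 * b := fun hb h =>
    h.trans (mul_le_mul_of_nonneg_right hC24 hb)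
  have hC4 : Cd ^ 4 = (Cd ^ 2) ^ 2 := by ring
  have hP1 := hP' 1 le_rfl (by omega)
  have U1 : ∀ x : Fin (d 1) → ℝ,
      Hp ^ 2 * (x ⬝ᵥ ((pikq 1 * A⁻¹ * (pikq 1)ᵀ)⁻¹).mulVec x) ≤ Cd ^ 2 * (lminA * (x ⬝ᵥ x)) := by
    intro x
    have := Stmt7Aux.upper hP1 hA hC0 hlp (pow_pos hH0 1) (hi 1 le_rfl (by omega)) x
    simpa using this
  have N1 : ∀ x : Fin (d 1) → ℝ, 0 ≤ x ⬝ᵥ ((pikq 1 * A⁻¹ * (pikq 1)ᵀ)⁻¹).mulVec x :=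
    Stmt7Aux.quad_nonneg (Stmt7Aux.theta_pd hP1 hA).inv
  have L1 : ∀ x : Fin (d 1) → ℝ,
      lminA * (x ⬝ᵥ x) ≤ Cd ^ 2 * (x ⬝ᵥ ((pikq 1 * A⁻¹ * (pikq 1)ᵀ)⁻¹).mulVec x) := by
    intro v
    obtain ⟨x, hx, he⟩ := Stmt7Aux.lift hP1 hA v
    have h1 := Stmt7Aux.contr hP1 x
    rw [hx] at h1
    have h2 := hl.1 x
    have h3 := mul_le_mul_of_nonneg_left h1 hlp.le
    have h4 := mul_le_mul_of_nonneg_right hC2 (N1 v)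
    rw [he] at h2
    linarith
  refine ⟨fun x => ⟨up (N1 x) (L1 x), up (mul_nonneg hlp.le (Stmt7Aux.dp_nonneg x)) (U1 x)⟩, ?_, ?_⟩
  · intro x y
    rw [hC4]
    exact Stmt7Aux.condAux (g := 1) hlp one_pos (by positivity) (N1 y) (Stmt7Aux.dp_nonneg x)
      (by rw [one_mul]; exact U1 x) (by rw [one_mul]; exact L1 y) (Stmt7Aux.dp_nonneg y)
  intro k hk1 hkq
  have hPk := hP' (k + 1) (by omega) (by omega)
  have hWk := hW k hk1 hkq
  have U : ∀ z : Fin (d' (k + 1)) → ℝ, Hp ^ (2 * (k + 1)) *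
      (z ⬝ᵥ (W (k + 1) * (pikq (k + 1) * A⁻¹ * (pikq (k + 1))ᵀ)⁻¹ * (W (k + 1))ᵀ).mulVec z) ≤
        Cd ^ 2 * (lminA * (z ⬝ᵥ z)) := by
    intro z
    have := Stmt7Aux.upper hPk hA hC0 hlp (pow_pos hH0 (k + 1)) (hi (k + 1) (by omega) (by omega))
      ((W (k + 1))ᵀ.mulVec z)
    rw [Stmt7Aux.isom hWk] at this
    rw [Stmt7Aux.theta_quad, mul_comm 2, pow_mul]
    exact this
  have N : ∀ z : Fin (d' (k + 1)) → ℝ, 0 ≤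
      (z ⬝ᵥ (W (k + 1) * (pikq (k + 1) * A⁻¹ * (pikq (k + 1))ᵀ)⁻¹ * (W (k + 1))ᵀ).mulVec z) := by
    intro z
    rw [Stmt7Aux.theta_quad]
    exact Stmt7Aux.quad_nonneg (Stmt7Aux.theta_pd hPk hA).inv _
  have L : ∀ z : Fin (d' (k + 1)) → ℝ, lminA * (z ⬝ᵥ z) ≤ Cd ^ 2 * (Hp ^ (2 * k) *
      (z ⬝ᵥ (W (k + 1) * (pikq (k + 1) * A⁻¹ * (pikq (k + 1))ᵀ)⁻¹ *
        (W (k + 1))ᵀ).mulVec z)) := by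
    intro z
    rw [Stmt7Aux.theta_quad]
    have hz : (pim k).mulVec ((W (k + 1))ᵀ.mulVec z) = 0 := by
      have : (W (k + 1))ᵀ.mulVec z ∈ LinearMap.ker (Matrix.mulVecLin (pim k)) := by
        rw [← hker k hk1 hkq]
        exact ⟨z, rfl⟩
      simpa using this
    obtain ⟨x, hx, he⟩ := Stmt7Aux.lift hPk hA ((W (k + 1))ᵀ.mulVec z)
    have h1 := Stmt7Aux.contr hPk x
    rw [hx, Stmt7Aux.isom hWk] at h1
    have hx0 : (pikq k).mulVec x = 0 := by
      rw [hrec k hk1 hkq, ← Matrix.mulVec_mulVec, hx, hz]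
    have h2 := Stmt7Aux.kerbound hA hlp x (hii k hk1 hkq x hx0)
    rw [he, ← pow_mul, mul_comm k 2] at h2
    exact (mul_le_mul_of_nonneg_left h1 hlp.le).trans h2
  refine ⟨fun z => ⟨up (mul_nonneg (by positivity) (N z)) (L z),
    up (mul_nonneg hlp.le (Stmt7Aux.dp_nonneg z)) (U z)⟩, fun z w => ?_⟩
  rw [hC4]
  refine Stmt7Aux.condAux (g := Hp ^ (2 * k)) hlp (by positivity) (by positivity) (N w) (Stmt7Aux.dp_nonneg z)
    ?_ (L w) (Stmt7Aux.dp_nonneg w)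
  rw [← pow_add]
  exact U z
end

section
/- (Feshchenko's lemma, Lemma 9.2 of the paper.) Let V be a real Hilbert space and let V_1,…,V_n be finitely many closed linear subspaces of V. Let P_i denote the orthogonal projection of V onto V_i and set P̄ := P_1 + ⋯ + P_n. Then V_1 + ⋯ + V_n = V (i.e. every element of V can be written as v_1 + ⋯ + v_n with v_i ∈ V_i for each i) if and only if P̄ : V → V is bijective. -/
open scoped RealInnerProductSpace BigOperators

theorem stmt8 {V : Type*} [NormedAddCommGroup V] [InnerProductSpace ℝ V] [CompleteSpace V]
    {n : ℕ} (K : Fin n → Submodule ℝ V) (hK : ∀ i, IsClosed (K i : Set V))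
    (P : Fin n → V →L[ℝ] V)
    (hPmem : ∀ i x, P i x ∈ K i)
    (hPorth : ∀ i x, ∀ w ∈ K i, ⟪x - P i x, w⟫ = 0) :
    (∀ v : V, ∃ f : Fin n → V, (∀ i, f i ∈ K i) ∧ v = ∑ i, f i) ↔
      Function.Bijective ⇑(∑ i, P i) := by
  have hin : ∀ i x y, ⟪x, P i y⟫ = ⟪P i x, P i y⟫ := by
    intro i x y
    have h := hPorth i x (P i y) (hPmem i y)
    rw [inner_sub_left] at h
    linarith
  have hfix : ∀ i, ∀ w ∈ K i, P i w = w := by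
    intro i w hw
    have h := hPorth i w (w - P i w) ((K i).sub_mem hw (hPmem i w))
    exact (sub_eq_zero.1 (inner_self_eq_zero.1 h)).symm
  constructor
  · intro hs
    let T : (Fin n → V) →L[ℝ] V :=
      ∑ i, (P i).comp (ContinuousLinearMap.proj (R := ℝ) (φ := fun _ : Fin n => V) i)
    have hT : ∀ x, T x = ∑ i, P i (x i) := by
      intro x
      simp [T, ContinuousLinearMap.sum_apply]
    have hsurj : Function.Surjective T := by
      intro v
      obtain ⟨f, hf, rfl⟩ := hs v
      exact ⟨f, by rw [hT]; exact Finset.sum_congr rfl fun i _ => hfix i _ (hf i)⟩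
    obtain ⟨C, hC, hpre⟩ := T.exists_preimage_norm_le hsurj
    have hbd : ∀ y, ‖y‖ ≤ C * ∑ i, ‖P i y‖ := by
      intro y
      obtain ⟨x, hx, hxn⟩ := hpre y
      rcases eq_or_ne y 0 with rfl | hy
      · simp
      have hy' : 0 < ‖y‖ := norm_pos_iff.2 hy
      have h1 : ‖y‖ * ‖y‖ ≤ ‖y‖ * (C * ∑ i, ‖P i y‖) := by
        calc ‖y‖ * ‖y‖ = ⟪y, T x⟫ := by rw [hx, real_inner_self_eq_norm_mul_norm]
          _ = ∑ i, ⟪P i y, x i⟫ := by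
              rw [hT, inner_sum]
              refine Finset.sum_congr rfl fun i _ => ?_
              rw [hin, real_inner_comm, ← hin, real_inner_comm]
          _ ≤ ∑ i, ‖P i y‖ * (C * ‖y‖) := by
              refine Finset.sum_le_sum fun i _ => ?_
              refine (real_inner_le_norm _ _).trans ?_
              gcongr
              exact (norm_le_pi_norm x i).trans hxn
          _ = _ := by rw [← Finset.sum_mul]; ring
      exact le_of_mul_le_mul_left h1 hy'
    let B : V →L[ℝ] V →L[ℝ] ℝ := (innerSL ℝ).comp (∑ i, P i)
    have hB : ∀ v w, B v w = ⟪(∑ i, P i) v, w⟫ := fun v w => rfl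
    have hBs : ∀ v, B v v = ∑ i, ‖P i v‖ ^ 2 := by
      intro v
      rw [hB, ContinuousLinearMap.sum_apply, sum_inner]
      refine Finset.sum_congr rfl fun i _ => ?_
      rw [real_inner_comm, hin, real_inner_self_eq_norm_sq]
    have hco : IsCoercive B := by
      refine ⟨1 / (C ^ 2 * n + 1), by positivity, fun v => ?_⟩
      rw [hBs]
      have h0 : 0 ≤ ∑ i, ‖P i v‖ ^ 2 := Finset.sum_nonneg fun i _ => by positivity
      have h1 : (∑ i, ‖P i v‖) ^ 2 ≤ n * ∑ i, ‖P i v‖ ^ 2 := by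
        simpa using sq_sum_le_card_mul_sum_sq (s := Finset.univ) (f := fun i => ‖P i v‖)
      have h2 : ‖v‖ ^ 2 ≤ C ^ 2 * (∑ i, ‖P i v‖) ^ 2 := by
        rw [← mul_pow]
        exact pow_le_pow_left₀ (norm_nonneg _) (hbd v) 2
      have h3 := mul_le_mul_of_nonneg_left h1 (sq_nonneg C)
      rw [mul_assoc, one_div, inv_mul_le_iff₀ (by positivity)]
      nlinarith
    have he : ⇑hco.continuousLinearEquivOfBilin = ⇑(∑ i, P i) := by
      funext v
      refine ext_inner_right ℝ fun w => ?_
      rw [hco.continuousLinearEquivOfBilin_apply, hB]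
    rw [← he]
    exact hco.continuousLinearEquivOfBilin.bijective
  · intro hb v
    obtain ⟨x, rfl⟩ := hb.2 v
    exact ⟨fun i => P i x, fun i => hPmem i x, by rw [ContinuousLinearMap.sum_apply]⟩
end

section
/- (Lemma 10.6 of the paper: the discrete decomposition and shorted operator.) Every x ∈ ℝ^N admits a unique decomposition x = πᵀ y + A z with y ∈ ℝ^k and z ∈ ker(π), and in this decomposition z = S x. The matrix S is symmetric and positive semidefinite, satisfies S x = 0 for every x in the column space of πᵀ, maps ker(π) bijectively onto itself, and on ker(π) it inverts P A P: for every x ∈ ker(π), x = P A P (S x). Moreover, in the decomposition of a given x ∈ ℝ^N, the vector y is the unique minimizer of (x − πᵀ y')ᵀ A⁻¹ (x − πᵀ y') over y' ∈ ℝ^k, and z is the unique minimizer of (x − A z')ᵀ A⁻¹ (x − A z') over z' ∈ ker(π). -/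
open scoped Matrix

theorem stmt13 {N k : ℕ} (hk : k ≤ N)
    (A : Matrix (Fin N) (Fin N) ℝ) (hA : A.PosDef)
    (pim : Matrix (Fin k) (Fin N) ℝ) (hrank : pim.rank = k)
    (S P : Matrix (Fin N) (Fin N) ℝ)
    (hS : S = A⁻¹ - A⁻¹ * pimᵀ * (pim * A⁻¹ * pimᵀ)⁻¹ * pim * A⁻¹)
    (hP : P = 1 - pimᵀ * (pim * pimᵀ)⁻¹ * pim) :
    (∀ x : Fin N → ℝ, ∃ (y : Fin k → ℝ) (z : Fin N → ℝ),
      pim.mulVec z = 0 ∧ x = (pimᵀ).mulVec y + A.mulVec z) ∧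
    (∀ (x : Fin N → ℝ) (y y' : Fin k → ℝ) (z z' : Fin N → ℝ),
      pim.mulVec z = 0 → x = (pimᵀ).mulVec y + A.mulVec z →
      pim.mulVec z' = 0 → x = (pimᵀ).mulVec y' + A.mulVec z' →
      y = y' ∧ z = z') ∧
    (∀ (x : Fin N → ℝ) (y : Fin k → ℝ) (z : Fin N → ℝ),
      pim.mulVec z = 0 → x = (pimᵀ).mulVec y + A.mulVec z → z = S.mulVec x) ∧
    Sᵀ = S ∧
    (∀ x : Fin N → ℝ, 0 ≤ x ⬝ᵥ S.mulVec x) ∧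
    (∀ y : Fin k → ℝ, S.mulVec ((pimᵀ).mulVec y) = 0) ∧
    Set.BijOn S.mulVec {z : Fin N → ℝ | pim.mulVec z = 0}
      {z : Fin N → ℝ | pim.mulVec z = 0} ∧
    (∀ x : Fin N → ℝ, pim.mulVec x = 0 → (P * A * P).mulVec (S.mulVec x) = x) ∧
    (∀ (x : Fin N → ℝ) (y : Fin k → ℝ) (z : Fin N → ℝ),
      pim.mulVec z = 0 → x = (pimᵀ).mulVec y + A.mulVec z →
      (∀ y' : Fin k → ℝ,
        (x - (pimᵀ).mulVec y) ⬝ᵥ (A⁻¹).mulVec (x - (pimᵀ).mulVec y) ≤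
          (x - (pimᵀ).mulVec y') ⬝ᵥ (A⁻¹).mulVec (x - (pimᵀ).mulVec y')) ∧
      (∀ y' : Fin k → ℝ,
        (x - (pimᵀ).mulVec y') ⬝ᵥ (A⁻¹).mulVec (x - (pimᵀ).mulVec y') =
          (x - (pimᵀ).mulVec y) ⬝ᵥ (A⁻¹).mulVec (x - (pimᵀ).mulVec y) → y' = y) ∧
      (∀ z' : Fin N → ℝ, pim.mulVec z' = 0 →
        (x - A.mulVec z) ⬝ᵥ (A⁻¹).mulVec (x - A.mulVec z) ≤
          (x - A.mulVec z') ⬝ᵥ (A⁻¹).mulVec (x - A.mulVec z')) ∧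
      (∀ z' : Fin N → ℝ, pim.mulVec z' = 0 →
        (x - A.mulVec z') ⬝ᵥ (A⁻¹).mulVec (x - A.mulVec z') =
          (x - A.mulVec z) ⬝ᵥ (A⁻¹).mulVec (x - A.mulVec z) → z' = z)) := by
  have hinj : ∀ y : Fin k → ℝ, pimᵀ.mulVec y = 0 → y = 0 := by
    have h1 : Module.finrank ℝ (LinearMap.range (pimᵀ).mulVecLin) = k := by
      have := Matrix.rank_transpose pim
      rw [hrank] at this
      exact this
    have h2 := LinearMap.finrank_range_add_finrank_ker (pimᵀ).mulVecLin
    rw [h1, Module.finrank_fin_fun] at h2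
    have h3 : LinearMap.ker (pimᵀ).mulVecLin = ⊥ := Submodule.finrank_eq_zero.mp (by omega)
    intro y hy
    have h4 : y ∈ LinearMap.ker (pimᵀ).mulVecLin := LinearMap.mem_ker.mpr hy
    rw [h3] at h4
    simpa using h4
  have hinj' : Function.Injective (pimᵀ).mulVec := by
    intro a b hab
    have := hinj (a - b) (by rw [Matrix.mulVec_sub]; exact sub_eq_zero.mpr hab)
    exact sub_eq_zero.mp this
  have hAT : Aᵀ = A := by simpa using hA.isHermitian.eq
  have hAi : A⁻¹.PosDef := hA.inv
  have hAiT : A⁻¹ᵀ = A⁻¹ := by simpa using hAi.isHermitian.eq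
  have hdet : IsUnit A.det := (Matrix.isUnit_iff_isUnit_det A).mp hA.isUnit
  have e1 : A * A⁻¹ = 1 := Matrix.mul_nonsing_inv A hdet
  have e2 : A⁻¹ * A = 1 := Matrix.nonsing_inv_mul A hdet
  have hT : (pim * A⁻¹ * pimᵀ).PosDef := by
    have := hAi.conjTranspose_mul_mul_same hinj'
    simpa using this
  have hG : (pim * pimᵀ).PosDef := by
    have := (Matrix.PosDef.one (n := Fin N) (R := ℝ)).conjTranspose_mul_mul_same hinj'
    simpa using this
  have hTT : ((pim * A⁻¹ * pimᵀ)⁻¹)ᵀ = (pim * A⁻¹ * pimᵀ)⁻¹ := by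
    simpa using hT.inv.isHermitian.eq
  have t1 := Matrix.mul_nonsing_inv _ ((Matrix.isUnit_iff_isUnit_det _).mp hT.isUnit)
  have t2 := Matrix.nonsing_inv_mul _ ((Matrix.isUnit_iff_isUnit_det _).mp hT.isUnit)
  have g1 := Matrix.mul_nonsing_inv _ ((Matrix.isUnit_iff_isUnit_det _).mp hG.isUnit)
  have g2 := Matrix.nonsing_inv_mul _ ((Matrix.isUnit_iff_isUnit_det _).mp hG.isUnit)
  generalize (pim * A⁻¹ * pimᵀ)⁻¹ = T at *
  generalize (pim * pimᵀ)⁻¹ = G at *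
  have hpS : pim * S = 0 := by
    have : pim * S = pim * A⁻¹ - (pim * A⁻¹ * pimᵀ * T) * (pim * A⁻¹) := by
      rw [hS]; simp only [Matrix.mul_sub, Matrix.mul_assoc]
    rw [this, t1, Matrix.one_mul, sub_self]
  have hSp : S * pimᵀ = 0 := by
    have : S * pimᵀ = A⁻¹ * pimᵀ - (A⁻¹ * pimᵀ) * (T * (pim * A⁻¹ * pimᵀ)) := by
      rw [hS]; simp only [Matrix.sub_mul, Matrix.mul_assoc]
    rw [this, t2, Matrix.mul_one, sub_self]
  have hAS : A * S = 1 - pimᵀ * (T * pim * A⁻¹) := by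
    have : A * S = A * A⁻¹ - (A * A⁻¹) * (pimᵀ * (T * pim * A⁻¹)) := by
      rw [hS]; simp only [Matrix.mul_sub, Matrix.mul_assoc]
    rw [this, e1, Matrix.one_mul]
  have hSA : S * A = 1 - A⁻¹ * pimᵀ * T * pim := by
    have : S * A = A⁻¹ * A - (A⁻¹ * pimᵀ * T * pim) * (A⁻¹ * A) := by
      rw [hS]; simp only [Matrix.sub_mul, Matrix.mul_assoc]
    rw [this, e2, Matrix.mul_one]
  have hST : Sᵀ = S := by
    rw [hS]
    simp only [Matrix.transpose_sub, Matrix.transpose_mul, hAiT, hTT, Matrix.transpose_transpose,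
      Matrix.mul_assoc]
  have hSAS : S * A * S = S := by
    rw [Matrix.mul_assoc, hAS, Matrix.mul_sub, ← Matrix.mul_assoc, hSp]; simp
  have hpP : pim * P = 0 := by
    have : pim * P = pim - (pim * pimᵀ * G) * pim := by
      rw [hP]; simp only [Matrix.mul_sub, Matrix.mul_assoc, Matrix.mul_one]
    rw [this, g1, Matrix.one_mul, sub_self]
  have hPp : P * pimᵀ = 0 := by
    have : P * pimᵀ = pimᵀ - pimᵀ * (G * (pim * pimᵀ)) := by
      rw [hP]; simp only [Matrix.sub_mul, Matrix.mul_assoc, Matrix.one_mul]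
    rw [this, g2, Matrix.mul_one, sub_self]
  have hPS : P * S = S := by
    rw [hP, Matrix.sub_mul, Matrix.mul_assoc, hpS]; simp
  have hSP : S * P = S := by
    rw [hP, Matrix.mul_sub, Matrix.mul_assoc, ← Matrix.mul_assoc, hSp]; simp
  have hPAS : P * A * P * S = P := by
    rw [Matrix.mul_assoc, hPS, Matrix.mul_assoc, hAS, Matrix.mul_sub, ← Matrix.mul_assoc, hPp]
    simp
  have hSpv : ∀ y, S.mulVec (pimᵀ.mulVec y) = 0 := by
    intro y; rw [Matrix.mulVec_mulVec, hSp, Matrix.zero_mulVec]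
  have hSAv : ∀ z, pim.mulVec z = 0 → S.mulVec (A.mulVec z) = z := by
    intro z hz
    rw [Matrix.mulVec_mulVec, hSA, Matrix.sub_mulVec, ← Matrix.mulVec_mulVec, hz]; simp
  have h3 : ∀ (x : Fin N → ℝ) (y : Fin k → ℝ) (z : Fin N → ℝ),
      pim.mulVec z = 0 → x = (pimᵀ).mulVec y + A.mulVec z → z = S.mulVec x := by
    intro x y z hz hx
    rw [hx, Matrix.mulVec_add, hSpv, hSAv z hz, zero_add]
  have h8 : ∀ x : Fin N → ℝ, pim.mulVec x = 0 → (P * A * P).mulVec (S.mulVec x) = x := by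
    intro x hx
    rw [Matrix.mulVec_mulVec, hPAS, hP, Matrix.sub_mulVec, ← Matrix.mulVec_mulVec, hx]; simp
  have hq : ∀ (w : Fin k → ℝ) (z : Fin N → ℝ), pim.mulVec z = 0 →
      (pimᵀ.mulVec w + A.mulVec z) ⬝ᵥ A⁻¹.mulVec (pimᵀ.mulVec w + A.mulVec z) =
      pimᵀ.mulVec w ⬝ᵥ A⁻¹.mulVec (pimᵀ.mulVec w) +
        A.mulVec z ⬝ᵥ A⁻¹.mulVec (A.mulVec z) := by
    intro w z hz
    have c0 : A⁻¹.mulVec (A.mulVec z) = z := by rw [Matrix.mulVec_mulVec, e2, Matrix.one_mulVec]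
    have c1 : pimᵀ.mulVec w ⬝ᵥ z = 0 := by
      rw [Matrix.mulVec_transpose, ← Matrix.dotProduct_mulVec, hz, dotProduct_zero]
    have c2 : A.mulVec z ⬝ᵥ A⁻¹.mulVec (pimᵀ.mulVec w) = 0 := by
      rw [Matrix.dotProduct_mulVec, ← Matrix.mulVec_transpose, hAiT, c0, dotProduct_comm, c1]
    rw [Matrix.mulVec_add, add_dotProduct, dotProduct_add, dotProduct_add, c2, c0, c1]
    ring
  have hnn : ∀ v : Fin N → ℝ, 0 ≤ v ⬝ᵥ A⁻¹.mulVec v := by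
    intro v; simpa using hAi.posSemidef.dotProduct_mulVec_nonneg v
  have hz0 : ∀ v : Fin N → ℝ, v ⬝ᵥ A⁻¹.mulVec v = 0 → v = 0 := by
    intro v hv
    by_contra hne
    have := hAi.dotProduct_mulVec_pos hne
    simp only [star_trivial] at this
    exact absurd hv this.ne'
  have hAinj : ∀ z : Fin N → ℝ, A.mulVec z = 0 → z = 0 := by
    intro z hz
    rw [← Matrix.one_mulVec z, ← e2, ← Matrix.mulVec_mulVec, hz, Matrix.mulVec_zero]
  refine ⟨?_, ?_, h3, hST, ?_, hSpv, ?_, h8, ?_⟩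
  · intro x
    refine ⟨(T * pim * A⁻¹).mulVec x, S.mulVec x, ?_, ?_⟩
    · rw [Matrix.mulVec_mulVec, hpS, Matrix.zero_mulVec]
    · rw [Matrix.mulVec_mulVec, Matrix.mulVec_mulVec, ← Matrix.add_mulVec, hAS]; simp
  · intro x y y' z z' hz hx hz' hx'
    have hzz : z = z' := (h3 x y z hz hx).trans (h3 x y' z' hz' hx').symm
    refine ⟨hinj' ?_, hzz⟩
    subst hzz
    exact add_right_cancel (hx.symm.trans hx')
  · intro x
    have h : x ⬝ᵥ S.mulVec x = S.mulVec x ⬝ᵥ A.mulVec (S.mulVec x) := by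
      conv_lhs => rw [← hSAS]
      rw [← Matrix.mulVec_mulVec, ← Matrix.mulVec_mulVec, Matrix.dotProduct_mulVec,
        ← Matrix.mulVec_transpose, hST]
    rw [h]
    simpa using hA.posSemidef.dotProduct_mulVec_nonneg (S.mulVec x)
  · refine ⟨?_, ?_, ?_⟩
    · intro x _
      change pim.mulVec (S.mulVec x) = 0
      rw [Matrix.mulVec_mulVec, hpS, Matrix.zero_mulVec]
    · intro a ha b hb hab
      rw [← h8 a ha, ← h8 b hb]
      exact congrArg _ hab
    · intro z hz
      refine ⟨P.mulVec (A.mulVec z), ?_, ?_⟩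
      · change pim.mulVec (P.mulVec (A.mulVec z)) = 0
        rw [Matrix.mulVec_mulVec, hpP, Matrix.zero_mulVec]
      · change S.mulVec (P.mulVec (A.mulVec z)) = z
        rw [Matrix.mulVec_mulVec, hSP, hSAv z hz]
  · intro x y z hz hx
    have r1 : ∀ y', x - pimᵀ.mulVec y' = pimᵀ.mulVec (y - y') + A.mulVec z := by
      intro y'; rw [hx, Matrix.mulVec_sub]; abel
    have r2 : ∀ z', x - A.mulVec z' = pimᵀ.mulVec y + A.mulVec (z - z') := by
      intro z'; rw [hx, Matrix.mulVec_sub]; abel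
    have k2 : ∀ z', pim.mulVec z' = 0 → pim.mulVec (z - z') = 0 := by
      intro z' hz'; rw [Matrix.mulVec_sub, hz, hz', sub_zero]
    have s1 : ∀ y', (x - pimᵀ.mulVec y') ⬝ᵥ A⁻¹.mulVec (x - pimᵀ.mulVec y') =
        pimᵀ.mulVec (y - y') ⬝ᵥ A⁻¹.mulVec (pimᵀ.mulVec (y - y')) +
        (x - pimᵀ.mulVec y) ⬝ᵥ A⁻¹.mulVec (x - pimᵀ.mulVec y) := by
      intro y'
      rw [r1 y', hq _ _ hz, r1 y, hq _ _ hz]; simp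
    have s2 : ∀ z', pim.mulVec z' = 0 → (x - A.mulVec z') ⬝ᵥ A⁻¹.mulVec (x - A.mulVec z') =
        (x - A.mulVec z) ⬝ᵥ A⁻¹.mulVec (x - A.mulVec z) +
        A.mulVec (z - z') ⬝ᵥ A⁻¹.mulVec (A.mulVec (z - z')) := by
      intro z' hz'
      rw [r2 z', hq _ _ (k2 z' hz'), r2 z, hq _ _ (k2 z hz)]; simp
    refine ⟨?_, ?_, ?_, ?_⟩
    · intro y'
      rw [s1 y']
      linarith [hnn (pimᵀ.mulVec (y - y'))]
    · intro y' h
      rw [s1 y'] at h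
      exact (sub_eq_zero.mp (hinj _ (hz0 _ (by linarith)))).symm
    · intro z' hz'
      rw [s2 z' hz']
      linarith [hnn (A.mulVec (z - z'))]
    · intro z' hz' h
      rw [s2 z' hz'] at h
      exact (sub_eq_zero.mp (hAinj _ (hz0 _ (by linarith)))).symm
end

section
/- (Lemma 10.4 of the paper: stability of Gram matrices and Galerkin projections under perturbation.) Assume er ≤ √(λ_min(B))/2. Then: (1) Cond(B') ≤ 8 Cond(B); (2) ‖B − B'‖₂ ≤ 3 √(λ_max(B)) · er; (3) ‖B⁻¹ − (B')⁻¹‖₂ ≤ 12 √(λ_max(B)) · (λ_min(B))⁻² · er; and (4) for every u ∈ H, writing u_m and u'_m for the orthogonal projections of u onto span{χ_1,…,χ_m} and span{χ'_1,…,χ'_m} respectively, ‖u_m − u'_m‖ ≤ 5 · er · ‖u‖ · Cond(B)/√(λ_min(B)). -/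
open scoped RealInnerProductSpace Matrix BigOperators

namespace GramAux
variable {H : Type*} [NormedAddCommGroup H] [InnerProductSpace ℝ H] {m : ℕ}

/-- Euclidean norm of a coordinate vector. -/
noncomputable def N (x : Fin m → ℝ) : ℝ := Real.sqrt (x ⬝ᵥ x)

/-- Synthesis map. -/
noncomputable def T (χ : Fin m → H) (x : Fin m → ℝ) : H := ∑ i, x i • χ i

lemma dot_nonneg (x : Fin m → ℝ) : 0 ≤ x ⬝ᵥ x :=
  Finset.sum_nonneg fun i _ => mul_self_nonneg (x i)

lemma N_nonneg (x : Fin m → ℝ) : 0 ≤ N x := Real.sqrt_nonneg _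

lemma N_sq (x : Fin m → ℝ) : N x ^ 2 = x ⬝ᵥ x := Real.sq_sqrt (dot_nonneg x)

lemma dot_le (x y : Fin m → ℝ) : x ⬝ᵥ y ≤ N x * N y := by
  have h := Finset.sum_mul_sq_le_sq_mul_sq Finset.univ x y
  refine le_of_abs_le (abs_le_of_sq_le_sq ?_ (mul_nonneg (N_nonneg x) (N_nonneg y)))
  rw [mul_pow, N_sq, N_sq]
  simpa [dotProduct, pow_two] using h

lemma T_sub (χ χ' : Fin m → H) (x : Fin m → ℝ) :
    T (fun i => χ i - χ' i) x = T χ x - T χ' x := by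
  simp [T, smul_sub, Finset.sum_sub_distrib]

lemma gram (χ : Fin m → H) (B : Matrix (Fin m) (Fin m) ℝ) (hB : ∀ i j, B i j = ⟪χ i, χ j⟫)
    (x y : Fin m → ℝ) : x ⬝ᵥ B.mulVec y = ⟪T χ x, T χ y⟫ := by
  simp only [T, sum_inner, inner_sum, dotProduct, Matrix.mulVec, hB, Finset.mul_sum,
    real_inner_smul_left, real_inner_smul_right]
  rw [Finset.sum_comm]
  refine Finset.sum_congr rfl fun i _ => Finset.sum_congr rfl fun j _ => ?_
  ring

lemma T_le (d : Fin m → H) (x : Fin m → ℝ) :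
    ‖T d x‖ ≤ Real.sqrt (∑ i, ‖d i‖ ^ 2) * N x := by
  have h1 : ‖T d x‖ ≤ ∑ i, ‖d i‖ * |x i| := by
    refine (norm_sum_le _ _).trans (Finset.sum_le_sum fun i _ => ?_)
    rw [norm_smul, Real.norm_eq_abs, mul_comm]
  have h := Finset.sum_mul_sq_le_sq_mul_sq Finset.univ (fun i => ‖d i‖) (fun i => |x i|)
  have hs : 0 ≤ ∑ i, ‖d i‖ ^ 2 := Finset.sum_nonneg fun i _ => sq_nonneg _
  refine h1.trans (le_of_abs_le (abs_le_of_sq_le_sq ?_ (mul_nonneg (Real.sqrt_nonneg _) (N_nonneg x))))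
  rw [mul_pow, N_sq, Real.sq_sqrt hs]
  simpa [dotProduct, pow_two] using h

lemma T_mem (χ : Fin m → H) (x : Fin m → ℝ) : T χ x ∈ Submodule.span ℝ (Set.range χ) :=
  Submodule.sum_mem _ fun i _ => Submodule.smul_mem _ _ (Submodule.subset_span ⟨i, rfl⟩)

lemma exists_T (χ : Fin m → H) {w : H} (hw : w ∈ Submodule.span ℝ (Set.range χ)) :
    ∃ x, w = T χ x := by
  obtain ⟨c, hc⟩ := (Submodule.mem_span_range_iff_exists_fun ℝ).1 hw
  exact ⟨c, hc.symm⟩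

lemma hs (d : Fin m → H) (v : OrthonormalBasis (Fin m) ℝ (EuclideanSpace ℝ (Fin m))) :
    ∑ k, ‖T d (v k).ofLp‖ ^ 2 = ∑ i, ‖d i‖ ^ 2 := by
  have key : ∀ i j, ∑ k, (v k) i * (v k) j = if i = j then 1 else 0 := by
    intro i j
    have := v.sum_inner_mul_inner (EuclideanSpace.single i 1) (EuclideanSpace.single j 1)
    simpa [EuclideanSpace.inner_single_left, EuclideanSpace.inner_single_right, eq_comm] using this
  have e : ∀ k, ‖T d (v k).ofLp‖ ^ 2 = ∑ i, ∑ j, ((v k) i * (v k) j) * ⟪d i, d j⟫ := by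
    intro k
    rw [← real_inner_self_eq_norm_sq]
    simp only [T, sum_inner, inner_sum, real_inner_smul_left, real_inner_smul_right]
    refine Finset.sum_congr rfl fun i _ => Finset.sum_congr rfl fun j _ => ?_
    rw [real_inner_comm]; ring
  simp only [e]
  rw [Finset.sum_comm]
  refine Finset.sum_congr rfl fun i _ => ?_
  rw [Finset.sum_comm]
  simp only [← Finset.sum_mul, key]
  simp

lemma lmin_pos (χ : Fin m → H) (hχ : LinearIndependent ℝ χ) :
    ∃ c > 0, ∀ x : Fin m → ℝ, c * (x ⬝ᵥ x) ≤ ‖T χ x‖ ^ 2 := by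
  let L : EuclideanSpace ℝ (Fin m) →ₗ[ℝ] H :=
    (Fintype.linearCombination ℝ χ) ∘ₗ (WithLp.linearEquiv 2 ℝ (Fin m → ℝ)).toLinearMap
  have hL : ∀ x : Fin m → ℝ, L (WithLp.toLp 2 x) = T χ x := fun x => by
    simp [L, T, Fintype.linearCombination_apply]
  have hk : L.ker = ⊥ := by
    rw [LinearMap.ker_eq_bot]
    exact (hχ.fintypeLinearCombination_injective).comp (LinearEquiv.injective _)
  obtain ⟨K, hK, h⟩ := L.exists_antilipschitzWith hk
  have hK' : (0:ℝ) < K := hK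
  refine ⟨1 / (K:ℝ)^2, by positivity, fun x => ?_⟩
  have := h.le_mul_dist (WithLp.toLp 2 x) 0
  rw [map_zero, dist_zero_right, dist_zero_right, hL] at this
  have h2 : x ⬝ᵥ x = ‖WithLp.toLp 2 x‖^2 := by
    rw [EuclideanSpace.real_norm_sq_eq]; simp [dotProduct, pow_two]
  rw [h2, one_div, inv_mul_le_iff₀ (by positivity), ← mul_pow]
  gcongr

/-- Extremal eigenvectors. -/
lemma extremal (hm : 1 ≤ m) (χ : Fin m → H) (B : Matrix (Fin m) (Fin m) ℝ)
    (hB : ∀ i j, B i j = ⟪χ i, χ j⟫) (l M : ℝ)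
    (hl : IsGreatest {t : ℝ | ∀ x : Fin m → ℝ, t * (x ⬝ᵥ x) ≤ x ⬝ᵥ B.mulVec x} l)
    (hM : IsLeast {t : ℝ | ∀ x : Fin m → ℝ, x ⬝ᵥ B.mulVec x ≤ t * (x ⬝ᵥ x)} M) :
    M ≤ l ∨ ∃ x y : Fin m → ℝ, N x = 1 ∧ N y = 1 ∧ M ≤ ‖T χ x‖ ^ 2 ∧ ‖T χ y‖ ^ 2 ≤ l ∧
      ∀ d : Fin m → H, ‖T d x‖ ^ 2 + ‖T d y‖ ^ 2 ≤ ∑ i, ‖d i‖ ^ 2 := by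
  have hA : B.IsHermitian := by
    ext i j; simp [hB, real_inner_comm]
  have : Nonempty (Fin m) := ⟨⟨0, hm⟩⟩
  set v := hA.eigenvectorBasis
  have hn : ∀ k, (v k).ofLp ⬝ᵥ (v k).ofLp = 1 := by
    intro k
    have := v.norm_eq_one k
    have h2 := EuclideanSpace.real_norm_sq_eq (v k)
    rw [this] at h2
    simpa [dotProduct, pow_two] using h2.symm
  have ev : ∀ k, ‖T χ (v k).ofLp‖ ^ 2 = hA.eigenvalues k := by
    intro k
    rw [← real_inner_self_eq_norm_sq, ← gram χ B hB, hA.mulVec_eigenvectorBasis k, dotProduct_smul]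
    change _ • ((v k).ofLp ⬝ᵥ (v k).ofLp) = _
    rw [hn]; simp
  have p1 : ∀ x y : Fin m → ℝ, ∑ k, (x ⬝ᵥ (v k).ofLp) * ((v k).ofLp ⬝ᵥ y) = x ⬝ᵥ y := by
    intro x y
    have := v.sum_inner_mul_inner (WithLp.toLp 2 x) (WithLp.toLp 2 y)
    simpa [PiLp.inner_apply, dotProduct, mul_comm] using this
  have p2 : ∀ (x : Fin m → ℝ) k, (v k).ofLp ⬝ᵥ B.mulVec x = hA.eigenvalues k * ((v k).ofLp ⬝ᵥ x) := by
    intro x k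
    rw [gram χ B hB, real_inner_comm, ← gram χ B hB, hA.mulVec_eigenvectorBasis k, dotProduct_smul,
      smul_eq_mul, dotProduct_comm]
  have q : ∀ x : Fin m → ℝ, x ⬝ᵥ B.mulVec x = ∑ k, hA.eigenvalues k * (x ⬝ᵥ (v k).ofLp) ^ 2 := by
    intro x
    rw [← p1]
    refine Finset.sum_congr rfl fun k _ => ?_
    rw [p2, dotProduct_comm (v k).ofLp x]; ring
  have q0 : ∀ x : Fin m → ℝ, x ⬝ᵥ x = ∑ k, (x ⬝ᵥ (v k).ofLp) ^ 2 := by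
    intro x
    rw [← p1]
    refine Finset.sum_congr rfl fun k _ => ?_
    rw [dotProduct_comm (v k).ofLp x]; ring
  obtain ⟨i, hi⟩ := Finite.exists_max hA.eigenvalues
  obtain ⟨j, hj⟩ := Finite.exists_min hA.eigenvalues
  have hMi : M ≤ hA.eigenvalues i := hM.2 fun x => by
    rw [q, q0, Finset.mul_sum]
    exact Finset.sum_le_sum fun k _ => mul_le_mul_of_nonneg_right (hi k) (sq_nonneg _)
  have hlj : hA.eigenvalues j ≤ l := hl.2 fun x => by
    rw [q, q0, Finset.mul_sum]
    exact Finset.sum_le_sum fun k _ => mul_le_mul_of_nonneg_right (hj k) (sq_nonneg _)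
  by_cases hij : i = j
  · left; subst hij; exact hMi.trans hlj
  · right
    refine ⟨(v i).ofLp, (v j).ofLp, by simp [N, hn], by simp [N, hn], (ev i).symm ▸ hMi,
      (ev j).symm ▸ hlj, fun d => ?_⟩
    rw [← hs d v, ← Finset.sum_pair hij (f := fun k => ‖T d (v k).ofLp‖ ^ 2)]
    exact Finset.sum_le_sum_of_subset_of_nonneg (Finset.subset_univ _) fun _ _ _ => sq_nonneg _

lemma inv_bound (B : Matrix (Fin m) (Fin m) ℝ) (c : ℝ) (hc : 0 < c)
    (h : ∀ x : Fin m → ℝ, c * (x ⬝ᵥ x) ≤ x ⬝ᵥ B.mulVec x) :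
    IsUnit B.det ∧ ∀ x, c * N (B⁻¹.mulVec x) ≤ N x := by
  have low : ∀ x, c * N x ≤ N (B.mulVec x) := by
    intro x
    have h1 := (h x).trans (dot_le _ _)
    rw [← N_sq] at h1
    rcases (N_nonneg x).eq_or_lt with h0 | h0
    · rw [← h0]; simpa using N_nonneg _
    · nlinarith
  have hu : IsUnit B := by
    rw [← Matrix.mulVec_injective_iff_isUnit]
    intro x y hxy
    have h0 := low (x - y)
    rw [Matrix.mulVec_sub, hxy, sub_self] at h0
    have h1 : N (x - y) = 0 := by
      have : N (0 : Fin m → ℝ) = 0 := by simp [N]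
      rw [this] at h0
      nlinarith [N_nonneg (x - y)]
    have h2 := N_sq (x - y)
    rw [h1] at h2
    exact sub_eq_zero.1 (dotProduct_self_eq_zero.1 (by simpa using h2.symm))
  have hd := (Matrix.isUnit_iff_isUnit_det B).1 hu
  refine ⟨hd, fun x => ?_⟩
  have := low (B⁻¹.mulVec x)
  rwa [Matrix.mulVec_mulVec, Matrix.mul_nonsing_inv _ hd, Matrix.one_mulVec] at this

lemma proj_bound (χ χ' : Fin m → H) (a e : ℝ) (ha : 0 < a) (he : 0 ≤ e)
    (hT : ∀ x, a * N x ≤ ‖T χ x‖) (hT' : ∀ x, a / 2 * N x ≤ ‖T χ' x‖)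
    (hD : ∀ x, ‖T χ x - T χ' x‖ ≤ e * N x) (u um um' : H)
    (h1 : um ∈ Submodule.span ℝ (Set.range χ))
    (h2 : ∀ w ∈ Submodule.span ℝ (Set.range χ), ⟪u - um, w⟫ = 0)
    (h3 : um' ∈ Submodule.span ℝ (Set.range χ'))
    (h4 : ∀ w ∈ Submodule.span ℝ (Set.range χ'), ⟪u - um', w⟫ = 0) :
    ‖um - um'‖ ≤ 3 * e * ‖u‖ / a := by
  have pyth : ‖u‖ ^ 2 = ‖um'‖ ^ 2 + ‖u - um'‖ ^ 2 := by
    have := h4 um' h3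
    have e1 : u = um' + (u - um') := by abel
    conv_lhs => rw [e1, norm_add_sq_real, real_inner_comm, this]
    ring
  have n1 : ‖um'‖ ≤ ‖u‖ :=
    le_of_abs_le (abs_le_of_sq_le_sq (by nlinarith [sq_nonneg ‖u - um'‖]) (norm_nonneg _))
  have n2 : ‖u - um'‖ ≤ ‖u‖ :=
    le_of_abs_le (abs_le_of_sq_le_sq (by nlinarith [sq_nonneg ‖um'‖]) (norm_nonneg _))
  obtain ⟨y, hy, hyo⟩ : ∃ y ∈ Submodule.span ℝ (Set.range χ),
      ∀ w ∈ Submodule.span ℝ (Set.range χ), ⟪um' - y, w⟫ = 0 := by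
    have : FiniteDimensional ℝ (Submodule.span ℝ (Set.range χ)) :=
      FiniteDimensional.span_of_finite ℝ (Set.finite_range χ)
    refine ⟨(Submodule.span ℝ (Set.range χ)).starProjection um',
      Submodule.starProjection_apply_mem _ _, fun w hw => ?_⟩
    exact Submodule.starProjection_inner_eq_zero _ _ hw
  obtain ⟨x', hx'⟩ := exists_T χ' h3
  obtain ⟨z, hz⟩ := exists_T χ (Submodule.sub_mem _ h1 hy)
  have b1 : ‖um' - y‖ ≤ e * N x' := by
    have e1 : ‖um' - y‖ ^ 2 = - ⟪um' - y, T χ x' - T χ' x'⟫ := by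
      rw [← real_inner_self_eq_norm_sq, inner_sub_right (um' - y) (T χ x'), hyo _ (T_mem χ x'),
        inner_sub_right, hyo _ hy, ← hx']
      ring
    have e2 := abs_real_inner_le_norm (um' - y) (T χ x' - T χ' x')
    have e3 := (neg_le_abs ⟪um' - y, T χ x' - T χ' x'⟫).trans e2
    rw [← e1] at e3
    rcases (norm_nonneg (um' - y)).eq_or_lt with h0 | h0
    · rw [← h0]; exact mul_nonneg he (N_nonneg _)
    · have := hD x'
      nlinarith
  have b2 : ‖um - y‖ * a ≤ e * ‖u‖ := by
    have e1 : ‖um - y‖ ^ 2 = ⟪u - um', T χ z - T χ' z⟫ := by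
      have k1 := h2 _ (T_mem χ z)
      have k2 := hyo _ (T_mem χ z)
      rw [inner_sub_right, h4 _ (T_mem χ' z), ← real_inner_self_eq_norm_sq]
      conv_lhs => rw [hz]
      have : u - um' = (u - um) + T χ z - (um' - y) := by rw [← hz]; abel
      rw [this, inner_sub_left, inner_add_left, k1, k2]
      ring
    have e3 := real_inner_le_norm (u - um') (T χ z - T χ' z)
    rw [← e1] at e3
    have e4 := hD z
    have e5 := hT z
    rw [← hz] at e5
    rcases (norm_nonneg (um - y)).eq_or_lt with h0 | h0
    · rw [← h0]; nlinarith [norm_nonneg u]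
    · have e6 : ‖u - um'‖ * ‖T χ z - T χ' z‖ ≤ ‖u‖ * (e * N z) :=
        mul_le_mul n2 e4 (norm_nonneg _) (norm_nonneg _)
      have e7 : a * ‖um - y‖ ^ 2 ≤ ‖u‖ * e * ‖um - y‖ := by
        calc a * ‖um - y‖ ^ 2 ≤ a * (‖u‖ * (e * N z)) :=
              mul_le_mul_of_nonneg_left (e3.trans e6) ha.le
          _ = (‖u‖ * e) * (a * N z) := by ring
          _ ≤ _ := mul_le_mul_of_nonneg_left e5 (by positivity)
      nlinarith
  have b3 : ‖um' - y‖ * a ≤ 2 * (e * ‖u‖) := by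
    have := hT' x'
    rw [← hx'] at this
    have k := mul_le_mul_of_nonneg_left (this.trans n1) he
    nlinarith
  rw [le_div_iff₀ ha]
  have tri : ‖um - um'‖ ≤ ‖um - y‖ + ‖um' - y‖ := by
    have : um - um' = (um - y) - (um' - y) := by abel
    rw [this]; exact norm_sub_le _ _
  nlinarith

lemma arith1 (a b α β : ℝ) (ha : 0 < a) (hab : a ≤ b) (hα : 0 ≤ α) (hβ : 0 ≤ β)
    (h : α ^ 2 + β ^ 2 ≤ (a / 2) ^ 2) : (b + α) ^ 2 * a ^ 2 ≤ 8 * b ^ 2 * (a - β) ^ 2 := by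
  have h1 : α + 2.8 * β ≤ 1.8 * a := by
    refine le_of_abs_le (abs_le_of_sq_le_sq ?_ (by positivity))
    nlinarith [sq_nonneg (2.8 * α - β)]
  have h2 : a + α ≤ 2.8 * (a - β) := by linarith
  have h3 : (b + α) * a ≤ b * (2.8 * (a - β)) := by nlinarith
  have h4 := pow_le_pow_left₀ (mul_nonneg (by linarith) ha.le) h3 2
  nlinarith [mul_nonneg (sq_nonneg b) (sq_nonneg (a - β))]

end GramAux

open GramAux in
theorem stmt14 {H : Type*} [NormedAddCommGroup H] [InnerProductSpace ℝ H] [CompleteSpace H]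
    {m : ℕ} (hm : 1 ≤ m)
    (χ χ' : Fin m → H) (hχ : LinearIndependent ℝ χ) (hχ' : LinearIndependent ℝ χ')
    (er : ℝ) (her : er = Real.sqrt (∑ i, ‖χ i - χ' i‖ ^ 2))
    (B B' : Matrix (Fin m) (Fin m) ℝ)
    (hB : ∀ i j, B i j = ⟪χ i, χ j⟫) (hB' : ∀ i j, B' i j = ⟪χ' i, χ' j⟫)
    (lminB lmaxB lminB' lmaxB' : ℝ)
    (hlminB : IsGreatest {t : ℝ | ∀ x : Fin m → ℝ, t * (x ⬝ᵥ x) ≤ x ⬝ᵥ B.mulVec x} lminB)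
    (hlmaxB : IsLeast {t : ℝ | ∀ x : Fin m → ℝ, x ⬝ᵥ B.mulVec x ≤ t * (x ⬝ᵥ x)} lmaxB)
    (hlminB' : IsGreatest {t : ℝ | ∀ x : Fin m → ℝ, t * (x ⬝ᵥ x) ≤ x ⬝ᵥ B'.mulVec x} lminB')
    (hlmaxB' : IsLeast {t : ℝ | ∀ x : Fin m → ℝ, x ⬝ᵥ B'.mulVec x ≤ t * (x ⬝ᵥ x)} lmaxB')
    (hsmall : er ≤ Real.sqrt lminB / 2) :
    lmaxB' / lminB' ≤ 8 * (lmaxB / lminB) ∧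
    (∀ x : Fin m → ℝ,
      Real.sqrt (((B - B').mulVec x) ⬝ᵥ ((B - B').mulVec x)) ≤
        3 * Real.sqrt lmaxB * er * Real.sqrt (x ⬝ᵥ x)) ∧
    (∀ x : Fin m → ℝ,
      Real.sqrt (((B⁻¹ - B'⁻¹).mulVec x) ⬝ᵥ ((B⁻¹ - B'⁻¹).mulVec x)) ≤
        12 * Real.sqrt lmaxB / lminB ^ 2 * er * Real.sqrt (x ⬝ᵥ x)) ∧
    (∀ u um um' : H,
      um ∈ Submodule.span ℝ (Set.range χ) →
      (∀ w ∈ Submodule.span ℝ (Set.range χ), ⟪u - um, w⟫ = 0) →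
      um' ∈ Submodule.span ℝ (Set.range χ') →
      (∀ w ∈ Submodule.span ℝ (Set.range χ'), ⟪u - um', w⟫ = 0) →
      ‖um - um'‖ ≤ 5 * er * ‖u‖ * (lmaxB / lminB) / Real.sqrt lminB) := by
  set a := Real.sqrt lminB with ha_def
  set b := Real.sqrt lmaxB with hb_def
  obtain ⟨c, hc, hcl⟩ := lmin_pos χ hχ
  have hg : ∀ x, x ⬝ᵥ B.mulVec x = ‖T χ x‖ ^ 2 := fun x => by
    rw [gram χ B hB, real_inner_self_eq_norm_sq]
  have hg' : ∀ x, x ⬝ᵥ B'.mulVec x = ‖T χ' x‖ ^ 2 := fun x => by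
    rw [gram χ' B' hB', real_inner_self_eq_norm_sq]
  have hl : 0 < lminB := lt_of_lt_of_le hc (hlminB.2 fun x => by rw [hg]; exact hcl x)
  have ha : 0 < a := Real.sqrt_pos.2 hl
  have ha2 : a ^ 2 = lminB := Real.sq_sqrt hl.le
  have one_vec : ∃ x : Fin m → ℝ, x ⬝ᵥ x = 1 := by
    refine ⟨Pi.single ⟨0, hm⟩ 1, by simp⟩
  obtain ⟨x1, hx1⟩ := one_vec
  have hlM : lminB ≤ lmaxB := by
    have h1 := hlminB.1 x1
    have h2 := hlmaxB.1 x1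
    rw [hx1] at h1 h2
    linarith
  have hb2 : b ^ 2 = lmaxB := Real.sq_sqrt (hl.le.trans hlM)
  have hab : a ≤ b := Real.sqrt_le_sqrt hlM
  have hb : 0 < b := ha.trans_le hab
  have he : 0 ≤ er := her ▸ Real.sqrt_nonneg _
  have hes : er ^ 2 = ∑ i, ‖χ i - χ' i‖ ^ 2 := by
    rw [her]; exact Real.sq_sqrt (Finset.sum_nonneg fun i _ => sq_nonneg _)
  have hD : ∀ x, ‖T χ x - T χ' x‖ ≤ er * N x := fun x => by
    rw [← T_sub, her]; exact T_le _ x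
  have hT : ∀ x, a * N x ≤ ‖T χ x‖ := fun x => by
    refine le_of_abs_le (abs_le_of_sq_le_sq ?_ (norm_nonneg _))
    rw [mul_pow, N_sq, ha2, ← hg]
    exact hlminB.1 x
  have hTb : ∀ x, ‖T χ x‖ ≤ b * N x := fun x => by
    refine le_of_abs_le (abs_le_of_sq_le_sq ?_ (mul_nonneg hb.le (N_nonneg _)))
    rw [mul_pow, N_sq, hb2, ← hg]
    exact hlmaxB.1 x
  have hT' : ∀ x, a / 2 * N x ≤ ‖T χ' x‖ := fun x => by
    have h1 := norm_sub_norm_le (T χ x) (T χ' x)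
    have h2 := hD x
    have h3 := hT x
    have h4 := mul_le_mul_of_nonneg_right hsmall (N_nonneg x)
    linarith
  have hTb' : ∀ x, ‖T χ' x‖ ≤ (b + er) * N x := fun x => by
    have h1 := norm_sub_norm_le (T χ' x) (T χ x)
    rw [norm_sub_rev] at h1
    have h2 := hD x
    have h3 := hTb x
    linarith
  have hq' : ∀ x : Fin m → ℝ, lminB / 4 * (x ⬝ᵥ x) ≤ x ⬝ᵥ B'.mulVec x := fun x => by
    rw [hg', ← N_sq, ← ha2]
    have := pow_le_pow_left₀ (mul_nonneg (by positivity) (N_nonneg x)) (hT' x) 2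
    nlinarith
  have hl' : 0 < lminB' := lt_of_lt_of_le (by positivity) (hlminB'.2 hq')
  have hcond : 1 ≤ lmaxB / lminB := (one_le_div hl).2 hlM
  have part2 : ∀ x : Fin m → ℝ, N ((B - B').mulVec x) ≤ 3 * b * er * N x := by
    intro x
    set y := (B - B').mulVec x with hy
    have h1 : N y ^ 2 = ⟪T χ y, T χ x - T χ' x⟫ + ⟪T χ y - T χ' y, T χ' x⟫ := by
      rw [N_sq]
      conv_lhs => rw [hy]
      rw [← hy, dotProduct_comm, hy, Matrix.sub_mulVec, dotProduct_sub, ← Matrix.sub_mulVec, ← hy,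
        gram χ B hB, gram χ' B' hB', inner_sub_right, inner_sub_left]
      ring
    have h2 := (real_inner_le_norm (T χ y) (T χ x - T χ' x)).trans
      (mul_le_mul (hTb y) (hD x) (norm_nonneg _) (mul_nonneg hb.le (N_nonneg y)))
    have h3 := (real_inner_le_norm (T χ y - T χ' y) (T χ' x)).trans
      (mul_le_mul (hD y) (hTb' x) (norm_nonneg _) (mul_nonneg he (N_nonneg y)))
    have hxx := N_nonneg x
    have h5 : N y ^ 2 ≤ (3 * b * er * N x) * N y := by
      have h6 : (b + er) ≤ 2 * b := by linarith
      have h7 : er * N y * ((b + er) * N x) ≤ er * N y * (2 * b * N x) := by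
        have := N_nonneg y
        gcongr
      nlinarith
    rcases (N_nonneg y).eq_or_lt with h0 | h0
    · rw [← h0]; positivity
    · nlinarith
  refine ⟨?_, part2, ?_, ?_⟩
  · rcases extremal hm χ' B' hB' lminB' lmaxB' hlminB' hlmaxB' with h | ⟨x, y, hx, hy, hM, hm', hd⟩
    · have : lmaxB' / lminB' ≤ 1 := (div_le_one hl').2 h
      linarith
    · have hd1 := hd (fun i => χ i - χ' i)
      rw [T_sub, T_sub, ← hes] at hd1
      have hd2 := hd1.trans (pow_le_pow_left₀ he hsmall 2)
      have key := arith1 a b _ _ ha hab (norm_nonneg _) (norm_nonneg _) hd2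
      set α := ‖T χ x - T χ' x‖ with hα
      set β := ‖T χ y - T χ' y‖ with hβ
      have k1 : ‖T χ' x‖ ≤ b + α := by
        have h1 := norm_sub_norm_le (T χ' x) (T χ x)
        rw [norm_sub_rev] at h1
        have h3 := hTb x
        rw [hx] at h3
        linarith
      have k2 : a - β ≤ ‖T χ' y‖ := by
        have h1 := norm_sub_norm_le (T χ y) (T χ' y)
        have h3 := hT y
        rw [hy] at h3
        linarith
      have k3 : 0 ≤ a - β := by
        have := hD y
        rw [hy] at this
        linarith
      have k4 := hM.trans (pow_le_pow_left₀ (norm_nonneg _) k1 2)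
      have k5 := (pow_le_pow_left₀ k3 k2 2).trans hm'
      rw [div_le_iff₀ hl', ← mul_div_assoc, div_mul_eq_mul_div, le_div_iff₀ hl, ← ha2, ← hb2]
      calc lmaxB' * a ^ 2 ≤ (b + α) ^ 2 * a ^ 2 := by gcongr
        _ ≤ _ := key
        _ ≤ _ := by gcongr
  · intro x
    obtain ⟨u1, i1⟩ := inv_bound B lminB hl hlminB.1
    obtain ⟨u2, i2⟩ := inv_bound B' (lminB / 4) (by positivity) hq'
    have e1 : B⁻¹ - B'⁻¹ = - (B⁻¹ * ((B - B') * B'⁻¹)) := by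
      rw [Matrix.sub_mul, Matrix.mul_nonsing_inv _ u2, Matrix.mul_sub, ← Matrix.mul_assoc,
        Matrix.nonsing_inv_mul _ u1]
      simp
    have e2 : N ((B⁻¹ - B'⁻¹).mulVec x) = N (B⁻¹.mulVec ((B - B').mulVec (B'⁻¹.mulVec x))) := by
      rw [e1, Matrix.neg_mulVec, ← Matrix.mulVec_mulVec, ← Matrix.mulVec_mulVec]
      simp [N]
    change N _ ≤ _ * N x
    rw [e2]
    have f1 := i1 ((B - B').mulVec (B'⁻¹.mulVec x))
    have f2 := part2 (B'⁻¹.mulVec x)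
    have f3 := i2 x
    rw [show 12 * b / lminB ^ 2 * er * N x = (12 * b * er * N x) / lminB ^ 2 by ring,
      le_div_iff₀ (by positivity)]
    have f4 := mul_le_mul_of_nonneg_left (f1.trans f2) hl.le
    have f5 := mul_le_mul_of_nonneg_left f3 (show 0 ≤ 12 * b * er by positivity)
    nlinarith
  · intro u um um' h1 h2 h3 h4
    refine (proj_bound χ χ' a er ha he hT hT' hD u um um' h1 h2 h3 h4).trans ?_
    have : 0 ≤ er * ‖u‖ := by positivity
    gcongr ?_ / _
    nlinarith
end

section
/- (Theorem 5.9 of the paper: minimax equality for the scaled average-case game.) One has inf_{v ∈ L(Φ,H)} sup_{μ ∈ M₂(H)} Ψ(v,μ) = sup_{μ ∈ M₂(H)} inf_{v ∈ L(Φ,H)} Ψ(v,μ) = 1. -/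
open MeasureTheory

theorem stmt19 {H : Type*} [NormedAddCommGroup H] [InnerProductSpace ℝ H] [CompleteSpace H]
    [TopologicalSpace.SeparableSpace H] [MeasurableSpace H] [BorelSpace H]
    {m : ℕ} (φ : Fin m → H →L[ℝ] ℝ) (hφ : LinearIndependent ℝ φ)
    (hex : ∃ u : H, u ≠ 0 ∧ ∀ i, φ i u = 0) :
    (⨅ v ∈ {v : H → H |
        @Measurable H H
          (MeasurableSpace.comap (fun u (i : Fin m) => φ i u) inferInstance)
          inferInstance v},
      ⨆ μ ∈ {μ : Measure H | IsProbabilityMeasure μ ∧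
          0 < ∫⁻ x, ENNReal.ofReal (‖x‖ ^ 2) ∂μ ∧
          ∫⁻ x, ENNReal.ofReal (‖x‖ ^ 2) ∂μ < ⊤},
      (∫⁻ x, ENNReal.ofReal (‖x - v x‖ ^ 2) ∂μ) /
        ∫⁻ x, ENNReal.ofReal (‖x‖ ^ 2) ∂μ) = 1 ∧
    (⨆ μ ∈ {μ : Measure H | IsProbabilityMeasure μ ∧
          0 < ∫⁻ x, ENNReal.ofReal (‖x‖ ^ 2) ∂μ ∧
          ∫⁻ x, ENNReal.ofReal (‖x‖ ^ 2) ∂μ < ⊤},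
      ⨅ v ∈ {v : H → H |
        @Measurable H H
          (MeasurableSpace.comap (fun u (i : Fin m) => φ i u) inferInstance)
          inferInstance v},
      (∫⁻ x, ENNReal.ofReal (‖x - v x‖ ^ 2) ∂μ) /
        ∫⁻ x, ENNReal.ofReal (‖x‖ ^ 2) ∂μ) = 1 := by
  obtain ⟨u, hu, hφu⟩ := hex
  have hle : ∀ {a b : ENNReal}, a ≤ 1 → b ≤ a → 1 ≤ b → a = 1 ∧ b = 1 := fun ha hba hb =>
    ⟨le_antisymm ha (hb.trans hba), le_antisymm (hba.trans ha) hb⟩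
  refine hle ?_ ?_ ?_
  · refine (iInf₂_le (fun _ => (0 : H)) ?_).trans ?_
    · exact @measurable_const _ _ _ (_) _
    · refine iSup₂_le fun μ hμ => ?_
      simp only [sub_zero]
      exact ENNReal.div_self_le_one
  · refine iSup₂_le fun μ hμ => le_iInf₂ fun v hv => (iInf₂_le v hv).trans ?_
    exact le_iSup₂_of_le (f := fun (μ : Measure H) _ => (∫⁻ x, ENNReal.ofReal (‖x - v x‖ ^ 2) ∂μ) /
        ∫⁻ x, ENNReal.ofReal (‖x‖ ^ 2) ∂μ) μ hμ le_rfl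
  · have hpos : 0 < ‖u‖ ^ 2 := by positivity
    have key : ∀ f : H → ENNReal,
        ∫⁻ x, f x ∂((2⁻¹ : ENNReal) • Measure.dirac u + (2⁻¹ : ENNReal) • Measure.dirac (-u))
          = 2⁻¹ * (f u + f (-u)) := by
      intro f
      simp [lintegral_add_measure, lintegral_smul_measure, mul_add]
    have hden : ∫⁻ x, ENNReal.ofReal (‖x‖ ^ 2)
        ∂((2⁻¹ : ENNReal) • Measure.dirac u + (2⁻¹ : ENNReal) • Measure.dirac (-u))
          = ENNReal.ofReal (‖u‖ ^ 2) := by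
      rw [key, norm_neg, ← two_mul, ← mul_assoc,
        ENNReal.inv_mul_cancel (by norm_num) (by norm_num), one_mul]
    refine le_iSup₂_of_le
      ((2⁻¹ : ENNReal) • Measure.dirac u + (2⁻¹ : ENNReal) • Measure.dirac (-u)) ?_ ?_
    · refine ⟨⟨?_⟩, ?_, ?_⟩
      · simp [ENNReal.inv_two_add_inv_two]
      · rw [hden]; exact ENNReal.ofReal_pos.2 hpos
      · rw [hden]; exact ENNReal.ofReal_lt_top
    · refine le_iInf₂ fun v hv => ?_
      have hvu : v (-u) = v u := by
        obtain ⟨s, -, hs⟩ := hv (measurableSet_singleton (v u))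
        have h1 : u ∈ v ⁻¹' {v u} := rfl
        rw [← hs] at h1
        have h2 : -u ∈ v ⁻¹' {v u} := by
          rw [← hs]
          simpa [Set.mem_preimage, hφu] using h1
        exact h2
      rw [hden, key, hvu, ENNReal.le_div_iff_mul_le (Or.inl (by simpa using hu))
        (Or.inl ENNReal.ofReal_ne_top), one_mul, ← ENNReal.ofReal_add (by positivity) (by positivity)]
      have h3 : (2 : ENNReal)⁻¹ = ENNReal.ofReal (2⁻¹) := by
        rw [ENNReal.ofReal_inv_of_pos (by norm_num)]; simp
      rw [h3, ← ENNReal.ofReal_mul (by norm_num)]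
      refine ENNReal.ofReal_le_ofReal ?_
      have h4 : ‖-u - v u‖ = ‖u + v u‖ := by
        rw [← norm_neg]; congr 1; abel
      rw [h4]
      have h5 := parallelogram_law_with_norm ℝ u (v u)
      nlinarith [mul_self_nonneg ‖v u‖]
end
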